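/- arXiv:cs/0106031 — 10 statements merged into one kernel-verified Lean document; each statement's English description precedes it below -/
import Mathlib

section
/- Let C be an ALC-concept in NNF and let A be any ABox obtained from the initial ABox {x₀ : C} by a finite sequence of applications of the ALC completion rules. Then in the induced graph G_A: (1) for every node x, the label L(x) has at most |C| elements; (2) every directed path in G_A has length at most |C|; and (3) the out-degree of G_A is bounded by |C|. -/
namespace Stmt2

/-- ALC-concepts: `C ::= A | ¬C | C₁ ⊓ C₂ | C₁ ⊔ C₂ | ∀R.C | ∃R.C`. -/
inductive Concept (NC NR : Type) : Type
  | atom : NC → Concept NC NR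
  | neg : Concept NC NR → Concept NC NR
  | inter : Concept NC NR → Concept NC NR → Concept NC NR
  | union : Concept NC NR → Concept NC NR → Concept NC NR
  | all : NR → Concept NC NR → Concept NC NR
  | ex : NR → Concept NC NR → Concept NC NR
  deriving DecidableEq

namespace Concept

variable {NC NR : Type}

/-- negation normal form: negation occurs only in front of concept names -/
def IsNNF : Concept NC NR → Prop
  | .atom _ => True
  | .neg (.atom _) => True
  | .neg _ => False
  | .inter C D => C.IsNNF ∧ D.IsNNF
  | .union C D => C.IsNNF ∧ D.IsNNF
  | .all _ C => C.IsNNF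
  | .ex _ C => C.IsNNF

/-- `|C|`, the number of symbols needed to write down `C` -/
def size : Concept NC NR → ℕ
  | .atom _ => 1
  | .neg C => C.size + 1
  | .inter C D => C.size + D.size + 1
  | .union C D => C.size + D.size + 1
  | .all _ C => C.size + 2
  | .ex _ C => C.size + 2

end Concept

/-- ABox assertions `x : C` and `(x,y) : R`, over individual names from `ℕ` -/
inductive Assertion (NC NR : Type) : Type
  | conc : ℕ → Concept NC NR → Assertion NC NR
  | role : ℕ → ℕ → NR → Assertion NC NR
  deriving DecidableEq

variable {NC NR : Type} [DecidableEq NC] [DecidableEq NR]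

/-- An ABox is a finite set of assertions. -/
abbrev ABox (NC NR : Type) [DecidableEq NC] [DecidableEq NR] := Finset (Assertion NC NR)

/-- the individual `z` occurs in the ABox `A` -/
def OccursIn (z : ℕ) (A : ABox NC NR) : Prop :=
  (∃ C, Assertion.conc z C ∈ A) ∨ (∃ y R, Assertion.role z y R ∈ A) ∨
    (∃ x R, Assertion.role x z R ∈ A)

/-- the ALC completion rules, as a one-step transformation relation on ABoxes -/
inductive Step : ABox NC NR → ABox NC NR → Prop
  | inter {A : ABox NC NR} {x : ℕ} {C₁ C₂ : Concept NC NR} :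
      Assertion.conc x (.inter C₁ C₂) ∈ A →
      ¬(Assertion.conc x C₁ ∈ A ∧ Assertion.conc x C₂ ∈ A) →
      Step A (insert (Assertion.conc x C₁) (insert (Assertion.conc x C₂) A))
  | union {A : ABox NC NR} {x : ℕ} {C₁ C₂ D : Concept NC NR} :
      Assertion.conc x (.union C₁ C₂) ∈ A →
      Assertion.conc x C₁ ∉ A → Assertion.conc x C₂ ∉ A →
      (D = C₁ ∨ D = C₂) →
      Step A (insert (Assertion.conc x D) A)
  | ex {A : ABox NC NR} {x : ℕ} {R : NR} {D : Concept NC NR} (y : ℕ) :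
      Assertion.conc x (.ex R D) ∈ A →
      ¬(∃ z, Assertion.role x z R ∈ A ∧ Assertion.conc z D ∈ A) →
      ¬OccursIn y A →
      Step A (insert (Assertion.role x y R) (insert (Assertion.conc y D) A))
  | all {A : ABox NC NR} {x y : ℕ} {R : NR} {D : Concept NC NR} :
      Assertion.conc x (.all R D) ∈ A →
      Assertion.role x y R ∈ A →
      Assertion.conc y D ∉ A →
      Step A (insert (Assertion.conc y D) A)

namespace Concept

def rd {NC NR : Type} : Concept NC NR → ℕ
  | .atom _ => 0
  | .neg _ => 0
  | .inter C D => max C.rd D.rd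
  | .union C D => max C.rd D.rd
  | .all _ C => C.rd + 1
  | .ex _ C => C.rd + 1

theorem rd_le_size {NC NR : Type} (C : Concept NC NR) : C.rd ≤ C.size := by
  induction C <;> simp only [rd, size] <;> omega

def sub : Concept NC NR → Finset (Concept NC NR)
  | .atom a => {.atom a}
  | .neg C => {.neg C}
  | .inter C D => insert (.inter C D) (C.sub ∪ D.sub)
  | .union C D => insert (.union C D) (C.sub ∪ D.sub)
  | .all R C => insert (.all R C) C.sub
  | .ex R C => insert (.ex R C) C.sub

theorem self_mem_sub (C : Concept NC NR) : C ∈ C.sub := by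
  cases C <;> simp [sub]

theorem card_sub_le (C : Concept NC NR) : C.sub.card ≤ C.size := by
  induction C with
  | atom a => simp [sub, size]
  | neg C ih => simp [sub, size]
  | inter C D h1 h2 =>
    simp only [sub, size]
    have := Finset.card_insert_le (Concept.inter C D) (C.sub ∪ D.sub)
    have := Finset.card_union_le C.sub D.sub
    omega
  | union C D h1 h2 =>
    simp only [sub, size]
    have := Finset.card_insert_le (Concept.union C D) (C.sub ∪ D.sub)
    have := Finset.card_union_le C.sub D.sub
    omega
  | all R C h =>
    simp only [sub, size]
    have := Finset.card_insert_le (Concept.all R C) C.sub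
    omega
  | ex R C h =>
    simp only [sub, size]
    have := Finset.card_insert_le (Concept.ex R C) C.sub
    omega

theorem sub_trans (C D : Concept NC NR) (h : D ∈ C.sub) : D.sub ⊆ C.sub := by
  induction C with
  | atom a => simp only [sub, Finset.mem_singleton] at h; subst h; rfl
  | neg C ih => simp only [sub, Finset.mem_singleton] at h; subst h; rfl
  | inter C E h1 h2 =>
    simp only [sub, Finset.mem_insert, Finset.mem_union] at h
    rcases h with rfl | h | h
    · rfl
    · intro z hz; simp [sub, h1 h hz]
    · intro z hz; simp [sub, h2 h hz]
  | union C E h1 h2 =>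
    simp only [sub, Finset.mem_insert, Finset.mem_union] at h
    rcases h with rfl | h | h
    · rfl
    · intro z hz; simp [sub, h1 h hz]
    · intro z hz; simp [sub, h2 h hz]
  | all R C h1 =>
    simp only [sub, Finset.mem_insert] at h
    rcases h with rfl | h
    · rfl
    · intro z hz; simp [sub, h1 h hz]
  | ex R C h1 =>
    simp only [sub, Finset.mem_insert] at h
    rcases h with rfl | h
    · rfl
    · intro z hz; simp [sub, h1 h hz]

end Concept

structure Inv (C : Concept NC NR) (A : ABox NC NR) (l : ℕ → ℕ) (g : ℕ → Concept NC NR) : Prop where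
  sub : ∀ x D, Assertion.conc x D ∈ A → D ∈ C.sub
  dep : ∀ x D, Assertion.conc x D ∈ A → D.rd + l x ≤ C.rd
  lev : ∀ x y R, Assertion.role x y R ∈ A → l y = l x + 1 ∧ l y ≤ C.rd
  wit : ∀ x y R, Assertion.role x y R ∈ A →
    ∃ D, g y = .ex R D ∧ Assertion.conc x (.ex R D) ∈ A ∧ Assertion.conc y D ∈ A
  inj : ∀ x y z R S, Assertion.role x y R ∈ A → Assertion.role x z S ∈ A → g y = g z → y = z

theorem Inv.add {C : Concept NC NR} {A : ABox NC NR} {l : ℕ → ℕ} {g : ℕ → Concept NC NR}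
    (h : Inv C A l g) (x : ℕ) (D : Concept NC NR) (h1 : D ∈ C.sub) (h2 : D.rd + l x ≤ C.rd) :
    Inv C (insert (Assertion.conc x D) A) l g := by
  constructor
  · intro z E hz
    simp only [Finset.mem_insert, Assertion.conc.injEq] at hz
    rcases hz with ⟨rfl, rfl⟩ | hz
    · exact h1
    · exact h.sub _ _ hz
  · intro z E hz
    simp only [Finset.mem_insert, Assertion.conc.injEq] at hz
    rcases hz with ⟨rfl, rfl⟩ | hz
    · exact h2
    · exact h.dep _ _ hz
  · intro z y R hz
    simp only [Finset.mem_insert, reduceCtorEq, false_or] at hz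
    exact h.lev _ _ _ hz
  · intro z y R hz
    simp only [Finset.mem_insert, reduceCtorEq, false_or] at hz
    obtain ⟨D, a, b, c⟩ := h.wit _ _ _ hz
    exact ⟨D, a, Finset.mem_insert_of_mem b, Finset.mem_insert_of_mem c⟩
  · intro z y w R S hz hw
    simp only [Finset.mem_insert, reduceCtorEq, false_or] at hz hw
    exact h.inj _ _ _ _ _ hz hw

theorem Inv.step {C : Concept NC NR} {A B : ABox NC NR} {l : ℕ → ℕ} {g : ℕ → Concept NC NR}
    (h : Inv C A l g) (hs : Step A B) : ∃ l g, Inv C B l g := by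
  cases hs with
  | @inter x C₁ C₂ hm _ =>
    have hsub := Concept.sub_trans _ _ (h.sub _ _ hm)
    have hd := h.dep _ _ hm
    simp only [Concept.rd] at hd
    refine ⟨l, g, (h.add x C₂ (hsub ?_) (by omega)).add x C₁ (hsub ?_) (by omega)⟩ <;>
      simp [Concept.sub, Concept.self_mem_sub]
  | @union x C₁ C₂ D hm _ _ hD =>
    have hsub := Concept.sub_trans _ _ (h.sub _ _ hm)
    have hd := h.dep _ _ hm
    simp only [Concept.rd] at hd
    rcases hD with rfl | rfl
    · refine ⟨l, g, h.add x _ (hsub ?_) (by omega)⟩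
      simp [Concept.sub, Concept.self_mem_sub]
    · refine ⟨l, g, h.add x _ (hsub ?_) (by omega)⟩
      simp [Concept.sub, Concept.self_mem_sub]
  | @all x y R D hm hr _ =>
    have hsub := Concept.sub_trans _ _ (h.sub _ _ hm)
    have hd := h.dep _ _ hm
    have hl := (h.lev _ _ _ hr).1
    simp only [Concept.rd] at hd
    refine ⟨l, g, h.add y D (hsub ?_) (by omega)⟩
    simp [Concept.sub, Concept.self_mem_sub]
  | @ex x R D y hm hn hf =>
    have hsub := Concept.sub_trans _ _ (h.sub _ _ hm)
    have hd := h.dep _ _ hm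
    simp only [Concept.rd] at hd
    have f1 : ∀ E, Assertion.conc y E ∉ A := fun E hE => hf (Or.inl ⟨E, hE⟩)
    have f2 : ∀ z S, Assertion.role y z S ∉ A := fun z S hE => hf (Or.inr (Or.inl ⟨z, S, hE⟩))
    have f3 : ∀ z S, Assertion.role z y S ∉ A := fun z S hE => hf (Or.inr (Or.inr ⟨z, S, hE⟩))
    have hxy : x ≠ y := by rintro rfl; exact f1 _ hm
    have hDs : D ∈ C.sub := hsub (by simp [Concept.sub, Concept.self_mem_sub])
    have key : ∀ z S, Assertion.role x z S ∈ A → g z ≠ .ex R D := by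
      intro z S hz he
      obtain ⟨E, a, b, c⟩ := h.wit _ _ _ hz
      rw [he] at a
      injection a with a1 a2
      subst a1 a2
      exact hn ⟨z, hz, c⟩
    refine ⟨Function.update l y (l x + 1), Function.update g y (.ex R D), ?_⟩
    obtain ⟨i1, i2, i3, i4, i5⟩ := h
    constructor
    · intro z E hz
      simp only [Finset.mem_insert, Assertion.conc.injEq, reduceCtorEq, false_or] at hz
      grind
    · intro z E hz
      simp only [Finset.mem_insert, Assertion.conc.injEq, reduceCtorEq, false_or] at hz
      rcases hz with ⟨rfl, rfl⟩ | hz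
      · rw [Function.update_self]; omega
      · rw [Function.update_of_ne (by rintro rfl; exact f1 _ hz)]; exact i2 _ _ hz
    · intro z w S hz
      simp only [Finset.mem_insert, Assertion.role.injEq, reduceCtorEq, false_or] at hz
      rcases hz with ⟨rfl, rfl, rfl⟩ | hz
      · rw [Function.update_self, Function.update_of_ne hxy]; omega
      · rw [Function.update_of_ne (by rintro rfl; exact f3 _ _ hz),
          Function.update_of_ne (by rintro rfl; exact f2 _ _ hz)]
        exact i3 _ _ _ hz
    · intro z w S hz
      simp only [Finset.mem_insert, Assertion.role.injEq, reduceCtorEq, false_or] at hz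
      rcases hz with ⟨rfl, rfl, rfl⟩ | hz
      · exact ⟨D, by rw [Function.update_self], by simp [hm], by simp⟩
      · rw [Function.update_of_ne (by rintro rfl; exact f3 _ _ hz)]
        obtain ⟨E, a, b, c⟩ := i4 _ _ _ hz
        exact ⟨E, a, by simp [b], by simp [c]⟩
    · intro z w v S T hz hw he
      simp only [Finset.mem_insert, Assertion.role.injEq, reduceCtorEq, false_or] at hz hw
      rcases hz with ⟨rfl, rfl, rfl⟩ | hz <;> rcases hw with ⟨h1, rfl, rfl⟩ | hw
      · rfl
      · rw [Function.update_self, Function.update_of_ne (by rintro rfl; exact f3 _ _ hw)] at he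
        exact absurd he.symm (key _ _ hw)
      · subst h1
        rw [Function.update_self, Function.update_of_ne (by rintro rfl; exact f3 _ _ hz)] at he
        exact absurd he (key _ _ hz)
      · rw [Function.update_of_ne (by rintro rfl; exact f3 _ _ hz),
          Function.update_of_ne (by rintro rfl; exact f3 _ _ hw)] at he
        exact i5 _ _ _ _ _ hz hw he

theorem Inv.reach {C : Concept NC NR} {x₀ : ℕ} {A : ABox NC NR}
    (hA : Relation.ReflTransGen Step {Assertion.conc x₀ C} A) : ∃ l g, Inv C A l g := by
  induction hA with
  | refl =>
    refine ⟨fun _ => 0, fun _ => C, ?_, ?_, ?_, ?_, ?_⟩ <;> simp [Concept.self_mem_sub]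
  | tail _ hs ih =>
    obtain ⟨l, g, h⟩ := ih
    exact h.step hs

/-- For an ALC-concept `C` in NNF and any ABox `A` reachable from the initial ABox
`{x₀ : C}` by the completion rules, in the induced graph: (1) every node label has at
most `|C|` elements, (2) every directed path has length at most `|C|`, and (3) the
out-degree is bounded by `|C|`. -/
theorem alc_tree_bounds (C : Concept NC NR) (hC : C.IsNNF) (x₀ : ℕ) (A : ABox NC NR)
    (hA : Relation.ReflTransGen Step {Assertion.conc x₀ C} A) :
    (∀ x : ℕ, ({D | Assertion.conc x D ∈ A} : Set (Concept NC NR)).ncard ≤ C.size) ∧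
    (∀ (k : ℕ) (p : ℕ → ℕ),
      (∀ i < k, ∃ R, Assertion.role (p i) (p (i + 1)) R ∈ A) → k ≤ C.size) ∧
    (∀ x : ℕ, ({y | ∃ R, Assertion.role x y R ∈ A} : Set ℕ).ncard ≤ C.size) := by
  obtain ⟨l, g, h⟩ := Inv.reach hA
  refine ⟨fun x => ?_, fun k p hp => ?_, fun x => ?_⟩
  · refine le_trans ?_ C.card_sub_le
    rw [← Set.ncard_coe_finset]
    exact Set.ncard_le_ncard (fun D hD => h.sub x D hD) (Finset.finite_toSet _)
  · have hl : ∀ i ≤ k, l (p i) = l (p 0) + i := by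
      intro i
      induction i with
      | zero => simp
      | succ i ih =>
        intro hi
        obtain ⟨R, hR⟩ := hp i (by omega)
        have := (h.lev _ _ _ hR).1
        have := ih (by omega)
        omega
    have hs := C.rd_le_size
    cases k with
    | zero => omega
    | succ k =>
      obtain ⟨R, hR⟩ := hp k (by omega)
      have := (h.lev _ _ _ hR).2
      have := hl (k + 1) le_rfl
      omega
  · refine le_trans ?_ C.card_sub_le
    rw [← Set.ncard_coe_finset]
    refine Set.ncard_le_ncard_of_injOn g ?_ ?_ (Finset.finite_toSet _)
    · rintro y ⟨R, hR⟩
      obtain ⟨D, a, b, c⟩ := h.wit _ _ _ hR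
      rw [a]
      exact h.sub _ _ b
    · rintro y ⟨R, hR⟩ z ⟨S, hS⟩ he
      exact h.inj _ _ _ _ _ hR hS he

end Stmt2
end

section
/- Let A be an ABox all of whose concept assertions use ALC-concepts in NNF, containing no inequality assertions, which is complete (none of the ALC completion rules is applicable to A) and clash-free (there is no individual x and concept name A with {x : A, x : ¬A} ⊆ A). Then A is satisfiable; indeed the canonical interpretation I_A is a model of A. -/
namespace Stmt3

/-- ALC-concepts: `C ::= A | ¬C | C₁ ⊓ C₂ | C₁ ⊔ C₂ | ∀R.C | ∃R.C`. -/
inductive Concept (NC NR : Type) : Type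
  | atom : NC → Concept NC NR
  | neg : Concept NC NR → Concept NC NR
  | inter : Concept NC NR → Concept NC NR → Concept NC NR
  | union : Concept NC NR → Concept NC NR → Concept NC NR
  | all : NR → Concept NC NR → Concept NC NR
  | ex : NR → Concept NC NR → Concept NC NR
  deriving DecidableEq

namespace Concept

variable {NC NR : Type}

/-- negation normal form: negation occurs only in front of concept names -/
def IsNNF : Concept NC NR → Prop
  | .atom _ => True
  | .neg (.atom _) => True
  | .neg _ => False
  | .inter C D => C.IsNNF ∧ D.IsNNF
  | .union C D => C.IsNNF ∧ D.IsNNF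
  | .all _ C => C.IsNNF
  | .ex _ C => C.IsNNF

end Concept

/-- ABox assertions `x : C`, `(x,y) : R` and `x ≠̇ y`, over individual names from `ℕ` -/
inductive Assertion (NC NR : Type) : Type
  | conc : ℕ → Concept NC NR → Assertion NC NR
  | role : ℕ → ℕ → NR → Assertion NC NR
  | neq : ℕ → ℕ → Assertion NC NR
  deriving DecidableEq

/-- an interpretation: a non-empty domain together with a valuation of concept names,
role names and individual names -/
structure Interp (NC NR : Type) where
  Δ : Type
  nonempty : Nonempty Δ
  interpC : NC → Set Δ
  interpR : NR → Set (Δ × Δ)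
  interpI : ℕ → Δ

variable {NC NR : Type}

/-- semantics of ALC-concepts -/
def Interp.sem (I : Interp NC NR) : Concept NC NR → Set I.Δ
  | .atom A => I.interpC A
  | .neg C => (I.sem C)ᶜ
  | .inter C D => I.sem C ∩ I.sem D
  | .union C D => I.sem C ∪ I.sem D
  | .all R C => {x | ∀ y, (x, y) ∈ I.interpR R → y ∈ I.sem C}
  | .ex R C => {x | ∃ y, (x, y) ∈ I.interpR R ∧ y ∈ I.sem C}

def Interp.satisfies (I : Interp NC NR) : Assertion NC NR → Prop
  | .conc x C => I.interpI x ∈ I.sem C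
  | .role x y R => (I.interpI x, I.interpI y) ∈ I.interpR R
  | .neq x y => I.interpI x ≠ I.interpI y

variable [DecidableEq NC] [DecidableEq NR]

/-- An ABox is a finite set of assertions. -/
abbrev ABox (NC NR : Type) [DecidableEq NC] [DecidableEq NR] := Finset (Assertion NC NR)

def Interp.models (I : Interp NC NR) (A : ABox NC NR) : Prop := ∀ a ∈ A, I.satisfies a

/-- the individual `z` occurs in the ABox `A` -/
def OccursIn (z : ℕ) (A : ABox NC NR) : Prop :=
  (∃ C, Assertion.conc z C ∈ A) ∨ (∃ y R, Assertion.role z y R ∈ A) ∨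
    (∃ x R, Assertion.role x z R ∈ A) ∨ (∃ y, Assertion.neq z y ∈ A) ∨
    (∃ x, Assertion.neq x z ∈ A)

/-- the ALC completion rules, as a one-step transformation relation on ABoxes -/
inductive Step : ABox NC NR → ABox NC NR → Prop
  | inter {A : ABox NC NR} {x : ℕ} {C₁ C₂ : Concept NC NR} :
      Assertion.conc x (.inter C₁ C₂) ∈ A →
      ¬(Assertion.conc x C₁ ∈ A ∧ Assertion.conc x C₂ ∈ A) →
      Step A (insert (Assertion.conc x C₁) (insert (Assertion.conc x C₂) A))
  | union {A : ABox NC NR} {x : ℕ} {C₁ C₂ D : Concept NC NR} :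
      Assertion.conc x (.union C₁ C₂) ∈ A →
      Assertion.conc x C₁ ∉ A → Assertion.conc x C₂ ∉ A →
      (D = C₁ ∨ D = C₂) →
      Step A (insert (Assertion.conc x D) A)
  | ex {A : ABox NC NR} {x : ℕ} {R : NR} {D : Concept NC NR} (y : ℕ) :
      Assertion.conc x (.ex R D) ∈ A →
      ¬(∃ z, Assertion.role x z R ∈ A ∧ Assertion.conc z D ∈ A) →
      ¬OccursIn y A →
      Step A (insert (Assertion.role x y R) (insert (Assertion.conc y D) A))
  | all {A : ABox NC NR} {x y : ℕ} {R : NR} {D : Concept NC NR} :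
      Assertion.conc x (.all R D) ∈ A →
      Assertion.role x y R ∈ A →
      Assertion.conc y D ∉ A →
      Step A (insert (Assertion.conc y D) A)

/-- the canonical interpretation `I_A` induced by an ABox `A` -/
def canonical (A : ABox NC NR) : Interp NC NR where
  Δ := ℕ
  nonempty := ⟨0⟩
  interpC P := {x | Assertion.conc x (.atom P) ∈ A}
  interpR R := {p | Assertion.role p.1 p.2 R ∈ A}
  interpI x := x

/-- an upper bound for the individuals of an assertion -/
def Assertion.bnd : Assertion NC NR → ℕ
  | .conc x _ => x
  | .role x y _ => x + y
  | .neq x y => x + y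

theorem exists_fresh (A : ABox NC NR) : ∃ y, ¬OccursIn y A := by
  refine ⟨A.sup Assertion.bnd + 1, ?_⟩
  have key : ∀ a ∈ A, a.bnd ≤ A.sup Assertion.bnd := fun a ha => Finset.le_sup ha
  rintro (⟨C, h⟩ | ⟨y, R, h⟩ | ⟨x, R, h⟩ | ⟨y, h⟩ | ⟨x, h⟩) <;>
  · have := key _ h
    simp only [Assertion.bnd] at this
    omega

theorem canonical_sem (A : ABox NC NR)
    (hComplete : ∀ A' : ABox NC NR, ¬Step A A')
    (hClashFree : ¬∃ (x : ℕ) (P : NC),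
      Assertion.conc x (.atom P) ∈ A ∧ Assertion.conc x (.neg (.atom P)) ∈ A)
    (C : Concept NC NR) : C.IsNNF → ∀ x : ℕ, Assertion.conc x C ∈ A →
      (canonical A).interpI x ∈ (canonical A).sem C := by
  induction C with
  | atom P => exact fun _ x h => h
  | neg C _ =>
    intro hn x h
    cases C with
    | atom P => exact fun h' => hClashFree ⟨x, P, h', h⟩
    | _ => exact hn.elim
  | inter C D ihC ihD =>
    intro hn x h
    by_cases hc : Assertion.conc x C ∈ A ∧ Assertion.conc x D ∈ A
    · exact ⟨ihC hn.1 x hc.1, ihD hn.2 x hc.2⟩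
    · exact (hComplete _ (Step.inter h hc)).elim
  | union C D ihC ihD =>
    intro hn x h
    by_cases hc : Assertion.conc x C ∈ A
    · exact Or.inl (ihC hn.1 x hc)
    by_cases hd : Assertion.conc x D ∈ A
    · exact Or.inr (ihD hn.2 x hd)
    exact (hComplete _ (Step.union h hc hd (Or.inl rfl))).elim
  | all R C ih =>
    intro hn x h y hy
    by_cases hc : Assertion.conc y C ∈ A
    · exact ih hn y hc
    · exact (hComplete _ (Step.all h hy hc)).elim
  | ex R C ih =>
    intro hn x h
    by_cases hc : ∃ z, Assertion.role x z R ∈ A ∧ Assertion.conc z C ∈ A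
    · obtain ⟨z, hz, hz'⟩ := hc
      exact ⟨z, hz, ih hn z hz'⟩
    · obtain ⟨y, hy⟩ := exists_fresh A
      exact (hComplete _ (Step.ex y h hc hy)).elim

/-- A complete (no completion rule applicable) and clash-free ABox whose concept
assertions are in NNF and which contains no inequality assertions is satisfiable;
indeed the canonical interpretation is a model of it. -/
theorem complete_clashfree_satisfiable (A : ABox NC NR)
    (hNNF : ∀ (x : ℕ) (C : Concept NC NR), Assertion.conc x C ∈ A → C.IsNNF)
    (hNoNeq : ∀ x y : ℕ, Assertion.neq x y ∉ A)
    (hComplete : ∀ A' : ABox NC NR, ¬Step A A')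
    (hClashFree : ¬∃ (x : ℕ) (P : NC),
      Assertion.conc x (.atom P) ∈ A ∧ Assertion.conc x (.neg (.atom P)) ∈ A) :
    (∃ I : Interp NC NR, I.models A) ∧ (canonical A).models A := by
  have hm : (canonical A).models A := by
    intro a ha
    cases a with
    | conc x C => exact canonical_sem A hComplete hClashFree C (hNNF x C ha) x ha
    | role x y R => exact ha
    | neq x y => exact (hNoNeq x y ha).elim
  exact ⟨⟨_, hm⟩, hm⟩

end Stmt3
end

section
/- Let C = {(⋈₁ n₁ C₁), …, (⋈ₖ nₖ Cₖ)} be a CBox over ALCQI-concepts containing no restriction of the form (⩾ 0 C), and let Φ(C) be the TBox with nominals defined as follows: for each (⩽ nᵢ Cᵢ) ∈ C, Φ contains the axiom Cᵢ ⊑ oᵢ¹ ⊔ … ⊔ oᵢ^{nᵢ} (the empty disjunction being ⊥); for each (⩾ nᵢ Cᵢ) ∈ C, Φ contains the axioms oᵢʲ ⊑ Cᵢ for 1 ≤ j ≤ nᵢ and oᵢʲ ⊑ ¬oᵢ^ℓ for 1 ≤ j < ℓ ≤ nᵢ; here all the oᵢʲ are fresh, pairwise distinct nominals. Then the CBox C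 is satisfiable if and only if the TBox Φ(C) is satisfiable. -/
namespace Stmt5

/-- roles: role names and their inverses -/
inductive Role (NR : Type) : Type
  | name : NR → Role NR
  | inv : NR → Role NR

/-- ALCQI(O)-concepts over concept names `NC`, role names `NR` and nominals `NI`
(ALCQI-concepts are those with `NI = Empty`, i.e. using no nominals); `bot` is the
empty concept ⊥ -/
inductive Concept (NC NR NI : Type) : Type
  | bot : Concept NC NR NI
  | atom : NC → Concept NC NR NI
  | nom : NI → Concept NC NR NI
  | neg : Concept NC NR NI → Concept NC NR NI
  | inter : Concept NC NR NI → Concept NC NR NI → Concept NC NR NI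
  | union : Concept NC NR NI → Concept NC NR NI → Concept NC NR NI
  | all : Role NR → Concept NC NR NI → Concept NC NR NI
  | ex : Role NR → Concept NC NR NI → Concept NC NR NI
  | atLeast : ℕ → Role NR → Concept NC NR NI → Concept NC NR NI
  | atMost : ℕ → Role NR → Concept NC NR NI → Concept NC NR NI

variable {NC NR NI NI' : Type}

/-- renaming of nominals -/
def Concept.mapNom (f : NI → NI') : Concept NC NR NI → Concept NC NR NI'
  | .bot => .bot
  | .atom A => .atom A
  | .nom o => .nom (f o)
  | .neg C => .neg (C.mapNom f)
  | .inter C D => .inter (C.mapNom f) (D.mapNom f)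
  | .union C D => .union (C.mapNom f) (D.mapNom f)
  | .all r C => .all r (C.mapNom f)
  | .ex r C => .ex r (C.mapNom f)
  | .atLeast n r C => .atLeast n r (C.mapNom f)
  | .atMost n r C => .atMost n r (C.mapNom f)

structure Interp (NC NR NI : Type) where
  Δ : Type
  nonempty : Nonempty Δ
  interpC : NC → Set Δ
  interpR : NR → Set (Δ × Δ)
  interpN : NI → Δ

def Interp.roleSem (I : Interp NC NR NI) : Role NR → Set (I.Δ × I.Δ)
  | .name R => I.interpR R
  | .inv R => {p | (p.2, p.1) ∈ I.interpR R}

def Interp.sem (I : Interp NC NR NI) : Concept NC NR NI → Set I.Δ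
  | .bot => ∅
  | .atom A => I.interpC A
  | .nom o => {I.interpN o}
  | .neg C => (I.sem C)ᶜ
  | .inter C D => I.sem C ∩ I.sem D
  | .union C D => I.sem C ∪ I.sem D
  | .all r C => {x | ∀ y, (x, y) ∈ I.roleSem r → y ∈ I.sem C}
  | .ex r C => {x | ∃ y, (x, y) ∈ I.roleSem r ∧ y ∈ I.sem C}
  | .atLeast n r C => {x | (n : ℕ∞) ≤ {y | (x, y) ∈ I.roleSem r ∧ y ∈ I.sem C}.encard}
  | .atMost n r C => {x | {y | (x, y) ∈ I.roleSem r ∧ y ∈ I.sem C}.encard ≤ (n : ℕ∞)}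

/-- cardinality restrictions `(⩾ n C)` and `(⩽ n C)` -/
inductive CardRestriction (NC NR NI : Type) : Type
  | atLeast : ℕ → Concept NC NR NI → CardRestriction NC NR NI
  | atMost : ℕ → Concept NC NR NI → CardRestriction NC NR NI

def Interp.satCR (I : Interp NC NR NI) : CardRestriction NC NR NI → Prop
  | .atLeast n C => (n : ℕ∞) ≤ (I.sem C).encard
  | .atMost n C => (I.sem C).encard ≤ (n : ℕ∞)

/-- TBox axioms `C ⊑ D` and `C ≐ D` -/
inductive TAxiom (NC NR NI : Type) : Type
  | sub : Concept NC NR NI → Concept NC NR NI → TAxiom NC NR NI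
  | eq : Concept NC NR NI → Concept NC NR NI → TAxiom NC NR NI

def Interp.satAx (I : Interp NC NR NI) : TAxiom NC NR NI → Prop
  | .sub C D => I.sem C ⊆ I.sem D
  | .eq C D => I.sem C = I.sem D

/-- disjunction of a list of concepts; the empty disjunction is ⊥ -/
def bigU : List (Concept NC NR NI) → Concept NC NR NI
  | [] => .bot
  | [C] => C
  | C :: D :: l => .union C (bigU (D :: l))

/-- The translation `Φ(C)` of a CBox into a TBox with (fresh, pairwise distinct)
nominals `o i j` (for `i` the index of a restriction and `j < nᵢ`):
for `(⩽ nᵢ Cᵢ)` the axiom `Cᵢ ⊑ oᵢ⁰ ⊔ … ⊔ oᵢ^{nᵢ-1}` (empty disjunction being ⊥),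
for `(⩾ nᵢ Cᵢ)` the axioms `oᵢʲ ⊑ Cᵢ` (j < nᵢ) and `oᵢʲ ⊑ ¬oᵢˡ` (j < l < nᵢ). -/
def Phi {k : ℕ} (res : Fin k → CardRestriction NC NR Empty) :
    Set (TAxiom NC NR (Fin k × ℕ)) :=
  {ax | ∃ (i : Fin k) (n : ℕ) (Ci : Concept NC NR Empty),
      res i = .atMost n Ci ∧
      ax = .sub (Ci.mapNom Empty.elim)
        (bigU ((List.range n).map fun j => Concept.nom (i, j)))} ∪
  {ax | ∃ (i : Fin k) (n : ℕ) (Ci : Concept NC NR Empty) (j : ℕ),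
      res i = .atLeast n Ci ∧ j < n ∧
      ax = .sub (Concept.nom (i, j)) (Ci.mapNom Empty.elim)} ∪
  {ax | ∃ (i : Fin k) (n : ℕ) (Ci : Concept NC NR Empty) (j l : ℕ),
      res i = .atLeast n Ci ∧ j < l ∧ l < n ∧
      ax = .sub (Concept.nom (i, j)) (Concept.neg (Concept.nom (i, l)))}

def Interp.withNom (I : Interp NC NR NI) (f : NI' → I.Δ) : Interp NC NR NI' where
  Δ := I.Δ
  nonempty := I.nonempty
  interpC := I.interpC
  interpR := I.interpR
  interpN := f

theorem roleSem_withNom (I : Interp NC NR NI) (f : NI' → I.Δ) (r : Role NR) :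
    (I.withNom f).roleSem r = I.roleSem r := by
  cases r <;> rfl

theorem sem_withNom (I : Interp NC NR NI) (f : NI' → I.Δ) (g : NI → NI')
    (h : ∀ o, f (g o) = I.interpN o) (C : Concept NC NR NI) :
    (I.withNom f).sem (C.mapNom g) = I.sem C := by
  induction C with
  | bot => rfl
  | atom A => rfl
  | nom o =>
    show ({f (g o)} : Set I.Δ) = {I.interpN o}
    rw [h]
  | neg C ih => simp only [Concept.mapNom, Interp.sem, ih]; rfl
  | inter C D ih1 ih2 => simp only [Concept.mapNom, Interp.sem, ih1, ih2]; rfl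
  | union C D ih1 ih2 => simp only [Concept.mapNom, Interp.sem, ih1, ih2]; rfl
  | all r C ih => simp only [Concept.mapNom, Interp.sem, ih, roleSem_withNom]; rfl
  | ex r C ih => simp only [Concept.mapNom, Interp.sem, ih, roleSem_withNom]; rfl
  | atLeast n r C ih => simp only [Concept.mapNom, Interp.sem, ih, roleSem_withNom]; rfl
  | atMost n r C ih => simp only [Concept.mapNom, Interp.sem, ih, roleSem_withNom]; rfl

theorem sem_mapNom (J : Interp NC NR NI') (g : NI → NI') (C : Concept NC NR NI) :
    (J.withNom (fun o => J.interpN (g o))).sem C = J.sem (C.mapNom g) := by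
  have := sem_withNom (J.withNom (fun o => J.interpN (g o))) J.interpN g (fun _ => rfl) C
  exact this.symm

theorem mem_bigU (I : Interp NC NR NI) (l : List (Concept NC NR NI)) (x : I.Δ) :
    x ∈ I.sem (bigU l) ↔ ∃ C ∈ l, x ∈ I.sem C := by
  induction l with
  | nil => simp [bigU, Interp.sem]
  | cons C l ih =>
    cases l with
    | nil => simp [bigU]
    | cons D l =>
      have : I.sem (bigU (C :: D :: l)) = I.sem C ∪ I.sem (bigU (D :: l)) := rfl
      rw [this, Set.mem_union, ih]
      simp

theorem le_encard_iff {α : Type} [Nonempty α] (s : Set α) (n : ℕ) :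
    (n : ℕ∞) ≤ s.encard ↔
      ∃ f : ℕ → α, (∀ j < n, f j ∈ s) ∧ ∀ j l, j < l → l < n → f j ≠ f l := by
  constructor
  · intro h
    obtain ⟨t, hts, ht⟩ := Set.exists_subset_encard_eq h
    have hfin : t.Finite := Set.finite_of_encard_eq_coe ht
    have hle : (Set.Iio n).encard ≤ t.encard := by
      rw [ht, ← Finset.coe_Iio, Set.encard_coe_eq_coe_finsetCard]; simp
    obtain ⟨f, hf, hinj⟩ := (Set.finite_Iio n).exists_injOn_of_encard_le hle
    refine ⟨f, fun j hj => hts (hf hj), fun j l hjl hl he => ?_⟩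
    have := hinj (show j ∈ Set.Iio n from hjl.trans hl) hl he
    omega
  · rintro ⟨f, hf, hne⟩
    have hinj : Set.InjOn f (Set.Iio n) := by
      intro j hj l hl he
      rcases lt_trichotomy j l with h | h | h
      · exact absurd he (hne j l h hl)
      · exact h
      · exact absurd he.symm (hne l j h hj)
    have h1 := hinj.encard_image
    have h2 : (Set.Iio n).encard = n := by
      rw [← Finset.coe_Iio, Set.encard_coe_eq_coe_finsetCard]; simp
    rw [← h2, ← h1]
    apply Set.encard_le_encard
    rintro _ ⟨j, hj, rfl⟩
    exact hf j hj

theorem encard_le_iff {α : Type} [Nonempty α] (s : Set α) (n : ℕ) :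
    s.encard ≤ (n : ℕ∞) ↔ ∃ f : ℕ → α, ∀ x ∈ s, ∃ j < n, x = f j := by
  have h2 : (Set.Iio n).encard = n := by
    rw [← Finset.coe_Iio, Set.encard_coe_eq_coe_finsetCard]; simp
  constructor
  · intro h
    have hfin : s.Finite := Set.finite_of_encard_le_coe h
    rw [← h2] at h
    obtain ⟨g, hg, hinj⟩ := hfin.exists_injOn_of_encard_le h
    refine ⟨Function.invFunOn g s, fun x hx => ⟨g x, hg hx, ?_⟩⟩
    exact (hinj.leftInvOn_invFunOn hx).symm
  · rintro ⟨f, hf⟩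
    rw [← h2]
    refine le_trans (Set.encard_le_encard ?_) (Set.encard_image_le f _)
    intro x hx
    obtain ⟨j, hj, rfl⟩ := hf x hx
    exact ⟨j, hj, rfl⟩

/-- A CBox `{(⋈₁ n₁ C₁), …, (⋈ₖ nₖ Cₖ)}` over ALCQI-concepts containing no restriction
of the form `(⩾ 0 C)` is satisfiable iff the TBox `Φ(C)` with nominals is
satisfiable. -/
theorem cbox_sat_iff_tbox_sat {k : ℕ} (res : Fin k → CardRestriction NC NR Empty)
    (hno : ∀ (i : Fin k) (Ci : Concept NC NR Empty), res i ≠ .atLeast 0 Ci) :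
    (∃ I : Interp NC NR Empty, ∀ i : Fin k, I.satCR (res i)) ↔
    (∃ I : Interp NC NR (Fin k × ℕ), ∀ ax ∈ Phi res, I.satAx ax) := by
  constructor
  · rintro ⟨I, hI⟩
    haveI := I.nonempty
    have key : ∀ i : Fin k, ∃ f : ℕ → I.Δ,
        (∀ n C, res i = .atMost n C → ∀ x ∈ I.sem C, ∃ j < n, x = f j) ∧
        (∀ n C, res i = .atLeast n C →
          (∀ j < n, f j ∈ I.sem C) ∧ ∀ j l, j < l → l < n → f j ≠ f l) := by
      intro i
      have hi := hI i
      cases hr : res i with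
      | atLeast n C =>
        rw [hr] at hi
        obtain ⟨f, hf⟩ := (le_encard_iff _ _).1 hi
        refine ⟨f, by simp, ?_⟩
        rintro n' C' h
        cases h
        exact hf
      | atMost n C =>
        rw [hr] at hi
        obtain ⟨f, hf⟩ := (encard_le_iff _ _).1 hi
        refine ⟨f, ?_, by simp⟩
        rintro n' C' h
        cases h
        exact hf
    choose f hf1 hf2 using key
    have hs := sem_withNom I (fun p : Fin k × ℕ => f p.1 p.2) Empty.elim (fun o => o.elim)
    refine ⟨I.withNom (fun p => f p.1 p.2), ?_⟩
    rintro ax ((⟨i, n, C, hr, rfl⟩ | ⟨i, n, C, j, hr, hj, rfl⟩) | ⟨i, n, C, j, l, hr, hj, hl, rfl⟩)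
    · intro x hx
      rw [hs] at hx
      obtain ⟨j, hj, h⟩ := hf1 i n C hr x hx
      rw [mem_bigU]
      exact ⟨.nom (i, j), List.mem_map.2 ⟨j, List.mem_range.2 hj, rfl⟩, h⟩
    · intro x hx
      rw [hs]
      have hx' : x = f i j := hx
      rw [hx']
      exact (hf2 i n C hr).1 j hj
    · intro x hx hx2
      have hx' : x = f i j := hx
      have hx2' : x = f i l := hx2
      exact (hf2 i n C hr).2 j l hj hl (hx'.symm.trans hx2')
  · rintro ⟨J, hJ⟩
    haveI := J.nonempty
    refine ⟨J.withNom (fun o => J.interpN (Empty.elim o)), fun i => ?_⟩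
    cases hr : res i with
    | atLeast n C =>
      show (n : ℕ∞) ≤ Set.encard (Interp.sem _ C)
      rw [sem_mapNom]
      refine (le_encard_iff (α := J.Δ) _ _).2 ⟨fun j => J.interpN (i, j), ?_, ?_⟩
      · intro j hj
        exact hJ _ (Or.inl (Or.inr ⟨i, n, C, j, hr, hj, rfl⟩)) rfl
      · intro j l hj hl he
        exact hJ _ (Or.inr ⟨i, n, C, j, l, hr, hj, hl, rfl⟩) rfl he
    | atMost n C =>
      show Set.encard (Interp.sem _ C) ≤ (n : ℕ∞)
      rw [sem_mapNom]
      refine (encard_le_iff (α := J.Δ) _ _).2 ⟨fun j => J.interpN (i, j), ?_⟩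
      intro x hx
      have := hJ _ (Or.inl (Or.inl ⟨i, n, C, hr, rfl⟩)) hx
      rw [mem_bigU] at this
      obtain ⟨D, hD, hxD⟩ := this
      obtain ⟨j, hj, rfl⟩ := List.mem_map.1 hD
      exact ⟨j, List.mem_range.1 hj, hxD⟩


end Stmt5
end

section
/- Let n ≥ 1, let X₀,…,X_{n−1}, Y₀,…,Y_{n−1} be concept names and east, north role names, and let I be an interpretation and a, b ∈ Δ^I. If (a,b) ∈ east^I and a ∈ D_east^I, then xpos(b) ≡ xpos(a) + 1 (mod 2^n) and ypos(b) = ypos(a). If (a,b) ∈ north^I and a ∈ D_north^I, then ypos(b) ≡ ypos(a) + 1 (mod 2^n) and xpos(b) = xpos(a). -/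
namespace Stmt7

/-- the concept names `X₀, X₁, …` and `Y₀, Y₁, …` -/
inductive TNC : Type
  | X : ℕ → TNC
  | Y : ℕ → TNC

/-- the role names `east` and `north` -/
inductive TNR : Type
  | east : TNR
  | north : TNR

/-- ALC-concepts (with ⊤ and ⊥ for the empty conjunction/disjunction) -/
inductive Concept (NC NR : Type) : Type
  | top : Concept NC NR
  | bot : Concept NC NR
  | atom : NC → Concept NC NR
  | neg : Concept NC NR → Concept NC NR
  | inter : Concept NC NR → Concept NC NR → Concept NC NR
  | union : Concept NC NR → Concept NC NR → Concept NC NR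
  | all : NR → Concept NC NR → Concept NC NR
  | ex : NR → Concept NC NR → Concept NC NR

structure Interp (NC NR : Type) where
  Δ : Type
  nonempty : Nonempty Δ
  interpC : NC → Set Δ
  interpR : NR → Set (Δ × Δ)

variable {NC NR : Type}

def Interp.sem (I : Interp NC NR) : Concept NC NR → Set I.Δ
  | .top => Set.univ
  | .bot => ∅
  | .atom A => I.interpC A
  | .neg C => (I.sem C)ᶜ
  | .inter C D => I.sem C ∩ I.sem D
  | .union C D => I.sem C ∪ I.sem D
  | .all R C => {x | ∀ y, (x, y) ∈ I.interpR R → y ∈ I.sem C}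
  | .ex R C => {x | ∃ y, (x, y) ∈ I.interpR R ∧ y ∈ I.sem C}

/-- `C → D` abbreviates `¬C ⊔ D` -/
def impl (C D : Concept NC NR) : Concept NC NR := .union (.neg C) D

/-- conjunction of a list of concepts (empty conjunction = ⊤) -/
def bigI (l : List (Concept NC NR)) : Concept NC NR := l.foldr .inter .top

/-- disjunction of a list of concepts (empty disjunction = ⊥) -/
def bigU (l : List (Concept NC NR)) : Concept NC NR := l.foldr .union .bot

/-- the concept `D_east` (for the role `r = east` and bit-names `X`, `Y`);
`D_north` is obtained by exchanging `east` with `north` and the `X k` with the `Y k`,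
i.e. it is `Deast n Y X north`. -/
def Deast (n : ℕ) (X Y : ℕ → NC) (r : NR) : Concept NC NR :=
  .inter
    (bigI ((List.range n).map fun k =>
      impl (bigI ((List.range k).map fun j => .atom (X j)))
        (.inter (impl (.atom (X k)) (.all r (.neg (.atom (X k)))))
          (impl (.neg (.atom (X k))) (.all r (.atom (X k)))))))
    (.inter
      (bigI ((List.range n).map fun k =>
        impl (bigU ((List.range k).map fun j => .neg (.atom (X j))))
          (.inter (impl (.atom (X k)) (.all r (.atom (X k))))
            (impl (.neg (.atom (X k))) (.all r (.neg (.atom (X k))))))))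
      (bigI ((List.range n).map fun k =>
        .inter (impl (.atom (Y k)) (.all r (.atom (Y k))))
          (impl (.neg (.atom (Y k))) (.all r (.neg (.atom (Y k))))))))

/-- the number `Σ_{i<n} bᵢ·2^i` whose `i`-th bit `bᵢ` is 1 iff `a ∈ (P i)^I`;
`xpos = posVal I n TNC.X` and `ypos = posVal I n TNC.Y`. -/
noncomputable def posVal (I : Interp NC NR) (n : ℕ) (P : ℕ → NC) (a : I.Δ) : ℕ :=
  ∑ i ∈ Finset.range n, (I.interpC (P i)).indicator (fun _ => (1 : ℕ)) a * 2 ^ i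

theorem mem_bigI (I : Interp NC NR) (l : List (Concept NC NR)) (a : I.Δ) :
    a ∈ I.sem (bigI l) ↔ ∀ C ∈ l, a ∈ I.sem C := by
  induction l with
  | nil => simp [bigI, Interp.sem]
  | cons c l ih =>
    have : a ∈ I.sem (bigI (c :: l)) ↔ a ∈ I.sem c ∧ a ∈ I.sem (bigI l) := Iff.rfl
    rw [this, ih]; simp

theorem mem_bigU (I : Interp NC NR) (l : List (Concept NC NR)) (a : I.Δ) :
    a ∈ I.sem (bigU l) ↔ ∃ C ∈ l, a ∈ I.sem C := by
  induction l with
  | nil => simp [bigU, Interp.sem]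
  | cons c l ih =>
    have : a ∈ I.sem (bigU (c :: l)) ↔ a ∈ I.sem c ∨ a ∈ I.sem (bigU l) := Iff.rfl
    rw [this, ih]; simp

theorem mem_impl (I : Interp NC NR) (C D : Concept NC NR) (a : I.Δ) :
    a ∈ I.sem (impl C D) ↔ (a ∈ I.sem C → a ∈ I.sem D) := by
  have : a ∈ I.sem (impl C D) ↔ (¬ a ∈ I.sem C) ∨ a ∈ I.sem D := Iff.rfl
  rw [this]; tauto

theorem mem_inter (I : Interp NC NR) (C D : Concept NC NR) (a : I.Δ) :
    a ∈ I.sem (.inter C D) ↔ (a ∈ I.sem C ∧ a ∈ I.sem D) := Iff.rfl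

theorem mem_neg (I : Interp NC NR) (C : Concept NC NR) (a : I.Δ) :
    a ∈ I.sem (.neg C) ↔ ¬ a ∈ I.sem C := Iff.rfl

theorem mem_atom (I : Interp NC NR) (A : NC) (a : I.Δ) :
    a ∈ I.sem (.atom A) ↔ a ∈ I.interpC A := Iff.rfl

theorem mem_all (I : Interp NC NR) (r : NR) (C : Concept NC NR) (a : I.Δ) :
    a ∈ I.sem (.all r C) ↔ ∀ y, (a, y) ∈ I.interpR r → y ∈ I.sem C := Iff.rfl

theorem step_aux (n : ℕ) (X Y : ℕ → NC) (r : NR) (I : Interp NC NR) (a b : I.Δ)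
    (hr : (a, b) ∈ I.interpR r) (h : a ∈ I.sem (Deast n X Y r)) :
    posVal I n X b ≡ posVal I n X a + 1 [MOD 2 ^ n] ∧ posVal I n Y b = posVal I n Y a := by
  classical
  simp only [Deast, mem_inter, mem_bigI, mem_bigU, mem_impl, mem_neg, mem_atom, mem_all,
    List.mem_range, List.mem_map, exists_exists_and_eq_and, forall_exists_index, and_imp,
    forall_apply_eq_imp_iff₂] at h
  obtain ⟨h1, h2, h3⟩ := h
  constructor
  · have key : ∀ m, m ≤ n →
        ((∀ j < m, a ∈ I.interpC (X j)) ∧ posVal I m X b = 0 ∧ posVal I m X a + 1 = 2 ^ m) ∨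
        ((∃ j < m, a ∉ I.interpC (X j)) ∧ posVal I m X b = posVal I m X a + 1) := by
      intro m
      induction m with
      | zero => intro _; left; simp [posVal]
      | succ m ih =>
        intro hm
        have e : ∀ c, posVal I (m+1) X c = posVal I m X c +
            (I.interpC (X m)).indicator (fun _ => (1 : ℕ)) c * 2 ^ m := fun c => by
          simp [posVal, Finset.sum_range_succ]
        rw [e, e]
        rcases ih (by omega) with ⟨g, gb, ga⟩ | ⟨g, gb⟩
        · obtain ⟨k1, k2⟩ := h1 m (by omega) (fun j hj => g j hj)
          by_cases ha : a ∈ I.interpC (X m)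
          · have hb := k1 ha b hr
            left
            refine ⟨fun j hj => ?_, ?_, ?_⟩
            · rcases Nat.lt_succ_iff_lt_or_eq.1 hj with h | rfl
              · exact g j h
              · exact ha
            · simp [hb, gb]
            · simp only [ha, Set.indicator_of_mem]; rw [pow_succ]; omega
          · have hb := k2 ha b hr
            right
            refine ⟨⟨m, by omega, ha⟩, ?_⟩
            simp [ha, hb, gb, ga]
        · obtain ⟨j, hj, hja⟩ := g
          obtain ⟨k1, k2⟩ := h2 m (by omega) j hj hja
          right
          refine ⟨⟨j, by omega, hja⟩, ?_⟩
          by_cases ha : a ∈ I.interpC (X m)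
          · have hb := k1 ha b hr
            simp only [ha, hb, Set.indicator_of_mem]; omega
          · have hb := k2 ha b hr
            simp [ha, hb, gb]
    rcases key n le_rfl with ⟨_, gb, ga⟩ | ⟨_, gb⟩
    · rw [gb, ga]; simp [Nat.ModEq]
    · rw [gb]
  · unfold posVal
    refine Finset.sum_congr rfl fun i hi => ?_
    obtain ⟨k1, k2⟩ := h3 i (Finset.mem_range.1 hi)
    by_cases ha : a ∈ I.interpC (Y i)
    · have hb := k1 ha b hr
      simp [ha, hb]
    · have hb := k2 ha b hr
      simp [ha, hb]

/-- Along an `east`-edge whose source satisfies `D_east`, `xpos` increases by one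
modulo `2^n` and `ypos` is unchanged; along a `north`-edge whose source satisfies
`D_north`, `ypos` increases by one modulo `2^n` and `xpos` is unchanged. -/
theorem deast_dnorth_step (n : ℕ) (hn : 1 ≤ n) (I : Interp TNC TNR) (a b : I.Δ) :
    ((a, b) ∈ I.interpR TNR.east → a ∈ I.sem (Deast n TNC.X TNC.Y TNR.east) →
      posVal I n TNC.X b ≡ posVal I n TNC.X a + 1 [MOD 2 ^ n] ∧
        posVal I n TNC.Y b = posVal I n TNC.Y a) ∧
    ((a, b) ∈ I.interpR TNR.north → a ∈ I.sem (Deast n TNC.Y TNC.X TNR.north) →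
      posVal I n TNC.Y b ≡ posVal I n TNC.Y a + 1 [MOD 2 ^ n] ∧
        posVal I n TNC.X b = posVal I n TNC.X a) := by
  exact ⟨step_aux n _ _ _ I a b, step_aux n _ _ _ I a b⟩

end Stmt7
end

section
/- Let n ≥ 1 and let I be any model of the ALCQI-CBox C_n. Then the map pos : Δ^I → Z_{2^n} × Z_{2^n}, a ↦ (xpos(a), ypos(a)), is a bijection, and for all a, b ∈ Δ^I: (a,b) ∈ east^I iff xpos(b) ≡ xpos(a) + 1 (mod 2^n) and ypos(b) = ypos(a), and (a,b) ∈ north^I iff ypos(b) ≡ ypos(a) + 1 (mod 2^n) and xpos(b) = xpos(a). In other words, (Δ^I, east^I, north^I) is isomorphic to the torus U(2^n, 2^n) = Z_{2^n} × Z_{2^n} equipped with its horizontal and vertical successor relations. -/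
namespace Stmt8

/-- the concept names `X₀, X₁, …` and `Y₀, Y₁, …` -/
inductive TNC : Type
  | X : ℕ → TNC
  | Y : ℕ → TNC

/-- the role names `east` and `north` -/
inductive TNR : Type
  | east : TNR
  | north : TNR

/-- roles: role names and their inverses -/
inductive Role (NR : Type) : Type
  | name : NR → Role NR
  | inv : NR → Role NR

/-- ALCQI-concepts (with ⊤ and ⊥) -/
inductive Concept (NC NR : Type) : Type
  | top : Concept NC NR
  | bot : Concept NC NR
  | atom : NC → Concept NC NR
  | neg : Concept NC NR → Concept NC NR
  | inter : Concept NC NR → Concept NC NR → Concept NC NR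
  | union : Concept NC NR → Concept NC NR → Concept NC NR
  | all : Role NR → Concept NC NR → Concept NC NR
  | ex : Role NR → Concept NC NR → Concept NC NR
  | atLeast : ℕ → Role NR → Concept NC NR → Concept NC NR
  | atMost : ℕ → Role NR → Concept NC NR → Concept NC NR

structure Interp (NC NR : Type) where
  Δ : Type
  nonempty : Nonempty Δ
  interpC : NC → Set Δ
  interpR : NR → Set (Δ × Δ)

variable {NC NR : Type}

def Interp.roleSem (I : Interp NC NR) : Role NR → Set (I.Δ × I.Δ)
  | .name R => I.interpR R
  | .inv R => {p | (p.2, p.1) ∈ I.interpR R}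

def Interp.sem (I : Interp NC NR) : Concept NC NR → Set I.Δ
  | .top => Set.univ
  | .bot => ∅
  | .atom A => I.interpC A
  | .neg C => (I.sem C)ᶜ
  | .inter C D => I.sem C ∩ I.sem D
  | .union C D => I.sem C ∪ I.sem D
  | .all r C => {x | ∀ y, (x, y) ∈ I.roleSem r → y ∈ I.sem C}
  | .ex r C => {x | ∃ y, (x, y) ∈ I.roleSem r ∧ y ∈ I.sem C}
  | .atLeast n r C => {x | (n : ℕ∞) ≤ {y | (x, y) ∈ I.roleSem r ∧ y ∈ I.sem C}.encard}
  | .atMost n r C => {x | {y | (x, y) ∈ I.roleSem r ∧ y ∈ I.sem C}.encard ≤ (n : ℕ∞)}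

/-- cardinality restrictions `(⩾ n C)` and `(⩽ n C)` -/
inductive CardRestriction (NC NR : Type) : Type
  | atLeast : ℕ → Concept NC NR → CardRestriction NC NR
  | atMost : ℕ → Concept NC NR → CardRestriction NC NR

def Interp.satCR (I : Interp NC NR) : CardRestriction NC NR → Prop
  | .atLeast n C => (n : ℕ∞) ≤ (I.sem C).encard
  | .atMost n C => (I.sem C).encard ≤ (n : ℕ∞)

/-- `C → D` abbreviates `¬C ⊔ D` -/
def impl (C D : Concept NC NR) : Concept NC NR := .union (.neg C) D

/-- conjunction of a list of concepts (empty conjunction = ⊤) -/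
def bigI (l : List (Concept NC NR)) : Concept NC NR := l.foldr .inter .top

/-- disjunction of a list of concepts (empty disjunction = ⊥) -/
def bigU (l : List (Concept NC NR)) : Concept NC NR := l.foldr .union .bot

/-- the concept `D_east`; `D_north` is obtained by exchanging `east` with `north` and
the `X k` with the `Y k`, i.e. it is `Deast n Y X north`. -/
def Deast (n : ℕ) (X Y : ℕ → NC) (r : NR) : Concept NC NR :=
  .inter
    (bigI ((List.range n).map fun k =>
      impl (bigI ((List.range k).map fun j => .atom (X j)))
        (.inter (impl (.atom (X k)) (.all (.name r) (.neg (.atom (X k)))))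
          (impl (.neg (.atom (X k))) (.all (.name r) (.atom (X k)))))))
    (.inter
      (bigI ((List.range n).map fun k =>
        impl (bigU ((List.range k).map fun j => .neg (.atom (X j))))
          (.inter (impl (.atom (X k)) (.all (.name r) (.atom (X k))))
            (impl (.neg (.atom (X k))) (.all (.name r) (.neg (.atom (X k))))))))
      (bigI ((List.range n).map fun k =>
        .inter (impl (.atom (Y k)) (.all (.name r) (.atom (Y k))))
          (impl (.neg (.atom (Y k))) (.all (.name r) (.neg (.atom (Y k))))))))

/-- `C_{(0,0)} = ⨅_{k<n} ¬X_k ⊓ ⨅_{k<n} ¬Y_k` -/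
def Czero (n : ℕ) (X Y : ℕ → NC) : Concept NC NR :=
  .inter (bigI ((List.range n).map fun k => .neg (.atom (X k))))
    (bigI ((List.range n).map fun k => .neg (.atom (Y k))))

/-- `C_{(2^n-1,2^n-1)} = ⨅_{k<n} X_k ⊓ ⨅_{k<n} Y_k` -/
def Cmax (n : ℕ) (X Y : ℕ → NC) : Concept NC NR :=
  .inter (bigI ((List.range n).map fun k => .atom (X k)))
    (bigI ((List.range n).map fun k => .atom (Y k)))

/-- `(∀ C)` abbreviates `(⩽ 0 ¬C)` -/
def allCR (C : Concept NC NR) : CardRestriction NC NR := .atMost 0 (.neg C)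

/-- `(= 1 r ⊤)` abbreviates `(⩾ 1 r ⊤) ⊓ (⩽ 1 r ⊤)` -/
def exactlyOne (r : Role NR) : Concept NC NR := .inter (.atLeast 1 r .top) (.atMost 1 r .top)

/-- the CBox `C_n` defining the `2^n × 2^n` torus -/
def Cn (n : ℕ) (X Y : ℕ → NC) (east north : NR) : List (CardRestriction NC NR) :=
  [allCR (.ex (.name east) .top),
   allCR (.ex (.name north) .top),
   allCR (exactlyOne (.inv east)),
   allCR (exactlyOne (.inv north)),
   .atLeast 1 (Czero n X Y),
   .atLeast 1 (Cmax n X Y),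
   .atMost 1 (Cmax n X Y),
   allCR (.inter (Deast n X Y east) (Deast n Y X north))]

/-- `xpos` / `ypos`: the number `Σ_{i<n} bᵢ·2^i` whose `i`-th bit is 1 iff
`a ∈ (P i)^I` -/
noncomputable def posVal (I : Interp NC NR) (n : ℕ) (P : ℕ → NC) (a : I.Δ) : ℕ :=
  ∑ i ∈ Finset.range n, (I.interpC (P i)).indicator (fun _ => (1 : ℕ)) a * 2 ^ i

theorem torus_abs {D Z : Type} [AddCommGroupWithOne Z] (hZ : ∀ z : Z, ∃ k : ℕ, (k : Z) = z)
    (x y : D → Z) (E N : D → D → Prop)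
    (hE : ∀ a, ∃ b, E a b) (hN : ∀ a, ∃ b, N a b)
    (pE : ∀ b, ∃ a, E a b) (pN : ∀ b, ∃ a, N a b)
    (uE : ∀ a a' b, E a b → E a' b → a = a') (uN : ∀ a a' b, N a b → N a' b → a = a')
    (sE : ∀ a b, E a b → x b = x a + 1 ∧ y b = y a)
    (sN : ∀ a b, N a b → y b = y a + 1 ∧ x b = x a)
    (m : D)
    (um : ∀ a a', x a = -1 → y a = -1 → x a' = -1 → y a' = -1 → a = a') :
    Function.Bijective (fun a => (x a, y a)) ∧
    ∀ a b, (E a b ↔ (x b = x a + 1 ∧ y b = y a)) ∧ (N a b ↔ (y b = y a + 1 ∧ x b = x a)) := by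
  have i1 : ∀ l : ℕ, ∀ a a', x a = -1 → x a' = -1 → y a + l = -1 → y a' + l = -1 → a = a' := by
    intro l
    induction l with
    | zero => intro a a' h1 h2 h3 h4; exact um a a' h1 (by simpa using h3) h2 (by simpa using h4)
    | succ l ih =>
      intro a a' h1 h2 h3 h4
      obtain ⟨b, hb⟩ := hN a
      obtain ⟨b', hb'⟩ := hN a'
      have e1 := sN _ _ hb
      have e2 := sN _ _ hb'
      have : b = b' := ih b b' (by rw [e1.2, h1]) (by rw [e2.2, h2])
        (by rw [e1.1, ← h3]; push_cast; abel) (by rw [e2.1, ← h4]; push_cast; abel)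
      subst this
      exact uN _ _ _ hb hb'
  have i2 : ∀ k l : ℕ, ∀ a a', x a + k = -1 → x a' + k = -1 → y a + l = -1 → y a' + l = -1 →
      a = a' := by
    intro k l
    induction k with
    | zero => intro a a' h1 h2 h3 h4; exact i1 l a a' (by simpa using h1) (by simpa using h2) h3 h4
    | succ k ih =>
      intro a a' h1 h2 h3 h4
      obtain ⟨b, hb⟩ := hE a
      obtain ⟨b', hb'⟩ := hE a'
      have e1 := sE _ _ hb
      have e2 := sE _ _ hb'
      have : b = b' := ih b b' (by rw [e1.1, ← h1]; push_cast; abel)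
        (by rw [e2.1, ← h2]; push_cast; abel) (by rw [e1.2, h3]) (by rw [e2.2, h4])
      subst this
      exact uE _ _ _ hb hb'
  have inj : ∀ a a', x a = x a' → y a = y a' → a = a' := by
    intro a a' h1 h2
    obtain ⟨k, hk⟩ := hZ (-1 - x a)
    obtain ⟨l, hl⟩ := hZ (-1 - y a)
    exact i2 k l a a' (by rw [hk]; abel) (by rw [hk, h1]; abel) (by rw [hl]; abel)
      (by rw [hl, h2]; abel)
  have s1 : ∀ k : ℕ, ∀ a, ∃ b, x b = x a - k ∧ y b = y a := by
    intro k
    induction k with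
    | zero => intro a; exact ⟨a, by simp⟩
    | succ k ih =>
      intro a
      obtain ⟨b, h1, h2⟩ := ih a
      obtain ⟨c, hc⟩ := pE b
      have e := sE _ _ hc
      refine ⟨c, ?_, by rw [← e.2, h2]⟩
      rw [eq_sub_of_add_eq e.1.symm, h1]; push_cast; abel
  have s2 : ∀ k : ℕ, ∀ a, ∃ b, y b = y a - k ∧ x b = x a := by
    intro k
    induction k with
    | zero => intro a; exact ⟨a, by simp⟩
    | succ k ih =>
      intro a
      obtain ⟨b, h1, h2⟩ := ih a
      obtain ⟨c, hc⟩ := pN b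
      have e := sN _ _ hc
      refine ⟨c, ?_, by rw [← e.2, h2]⟩
      rw [eq_sub_of_add_eq e.1.symm, h1]; push_cast; abel
  refine ⟨⟨fun a a' h => inj a a' (congrArg Prod.fst h) (congrArg Prod.snd h), ?_⟩, ?_⟩
  · rintro ⟨u, v⟩
    obtain ⟨k, hk⟩ := hZ (x m - u)
    obtain ⟨l, hl⟩ := hZ (y m - v)
    obtain ⟨b, h1, h2⟩ := s1 k m
    obtain ⟨c, h3, h4⟩ := s2 l b
    refine ⟨c, ?_⟩
    simp only [Prod.mk.injEq]
    exact ⟨by rw [h4, h1, hk]; abel, by rw [h3, h2, hl]; abel⟩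
  · intro a b
    refine ⟨⟨sE a b, ?_⟩, ⟨sN a b, ?_⟩⟩
    · rintro ⟨h1, h2⟩
      obtain ⟨c, hc⟩ := pE b
      have e := sE _ _ hc
      have : c = a := inj c a (add_right_cancel (e.1.symm.trans h1)) (e.2.symm.trans h2)
      exact this ▸ hc
    · rintro ⟨h1, h2⟩
      obtain ⟨c, hc⟩ := pN b
      have e := sN _ _ hc
      have : c = a := inj c a (e.2.symm.trans h2) (add_right_cancel (e.1.symm.trans h1))
      exact this ▸ hc

theorem mem_bigI (I : Interp NC NR) (n : ℕ) (f : ℕ → Concept NC NR) (a : I.Δ) :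
    a ∈ I.sem (bigI ((List.range n).map f)) ↔ ∀ k < n, a ∈ I.sem (f k) := by
  have : ∀ l : List (Concept NC NR), a ∈ I.sem (bigI l) ↔ ∀ c ∈ l, a ∈ I.sem c := by
    intro l
    induction l with
    | nil => simp [bigI, Interp.sem]
    | cons c l ih =>
      have : bigI (c :: l) = .inter c (bigI l) := rfl
      rw [this, Interp.sem, Set.mem_inter_iff, ih]; simp
  rw [this]; simp

theorem mem_bigU (I : Interp NC NR) (n : ℕ) (f : ℕ → Concept NC NR) (a : I.Δ) :
    a ∈ I.sem (bigU ((List.range n).map f)) ↔ ∃ k < n, a ∈ I.sem (f k) := by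
  have : ∀ l : List (Concept NC NR), a ∈ I.sem (bigU l) ↔ ∃ c ∈ l, a ∈ I.sem c := by
    intro l
    induction l with
    | nil => simp [bigU, Interp.sem]
    | cons c l ih =>
      have : bigU (c :: l) = .union c (bigU l) := rfl
      rw [this, Interp.sem, Set.mem_union, ih]; simp
  rw [this]; simp

theorem mem_impl (I : Interp NC NR) (C D : Concept NC NR) (a : I.Δ) :
    a ∈ I.sem (impl C D) ↔ (a ∈ I.sem C → a ∈ I.sem D) := by
  rw [impl, Interp.sem, Interp.sem, Set.mem_union, Set.mem_compl_iff]; tauto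

theorem sat_allCR (I : Interp NC NR) (C : Concept NC NR) (h : I.satCR (allCR C)) (a : I.Δ) :
    a ∈ I.sem C := by
  simp only [allCR, Interp.satCR, Interp.sem, Nat.cast_zero, nonpos_iff_eq_zero,
    Set.encard_eq_zero, Set.compl_empty_iff] at h
  rw [h]; trivial

theorem posVal_succ (I : Interp NC NR) (n : ℕ) (P : ℕ → NC) (a : I.Δ) :
    posVal I (n + 1) P a =
      posVal I n P a + (I.interpC (P n)).indicator (fun _ => (1 : ℕ)) a * 2 ^ n := by
  rw [posVal, Finset.sum_range_succ]; rfl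

theorem posVal_bound (I : Interp NC NR) (P : ℕ → NC) (a : I.Δ) (n : ℕ) :
    posVal I n P a + 1 ≤ 2 ^ n ∧
    (posVal I n P a + 1 = 2 ^ n ↔ ∀ k < n, a ∈ I.interpC (P k)) := by
  induction n with
  | zero => simp [posVal]
  | succ n ih =>
    obtain ⟨h1, h2⟩ := ih
    rw [posVal_succ, Nat.forall_lt_succ_right, ← h2, pow_succ]
    have : 0 < 2 ^ n := by positivity
    by_cases h : a ∈ I.interpC (P n)
    · simp only [h, Set.indicator_of_mem]
      constructor
      · omega
      · simp only [and_true]; omega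
    · simp only [h, not_false_iff, Set.indicator_of_notMem, and_false, iff_false]
      constructor <;> omega

theorem posVal_incr (I : Interp NC NR) (P : ℕ → NC) (a b : I.Δ) (n : ℕ)
    (h1 : ∀ k < n, (∀ j < k, a ∈ I.interpC (P j)) → (b ∈ I.interpC (P k) ↔ a ∉ I.interpC (P k)))
    (h2 : ∀ k < n, (∃ j < k, a ∉ I.interpC (P j)) → (b ∈ I.interpC (P k) ↔ a ∈ I.interpC (P k))) :
    ((∀ k < n, a ∈ I.interpC (P k)) → posVal I n P b = 0) ∧
    ((∃ k < n, a ∉ I.interpC (P k)) → posVal I n P b = posVal I n P a + 1) := by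
  induction n with
  | zero => simp [posVal]
  | succ n ih =>
    obtain ⟨i1, i2⟩ := ih (fun k hk => h1 k (by omega)) (fun k hk => h2 k (by omega))
    have g1 := h1 n (by omega)
    have g2 := h2 n (by omega)
    have hb := (posVal_bound I P a n).2
    rw [posVal_succ, posVal_succ]
    by_cases hall : ∀ k < n, a ∈ I.interpC (P k)
    · have g := g1 hall
      have z := i1 hall
      have w := hb.2 hall
      by_cases ha : a ∈ I.interpC (P n)
      · have hbn : b ∉ I.interpC (P n) := by tauto
        refine ⟨fun _ => by simp [z, hbn], ?_⟩
        rintro ⟨k, hk, hk'⟩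
        rcases Nat.lt_succ_iff_lt_or_eq.1 hk with h | h
        · exact absurd (hall k h) hk'
        · subst h; exact absurd ha hk'
      · have hbn : b ∈ I.interpC (P n) := by tauto
        refine ⟨fun h => absurd (h n (by omega)) ha, fun _ => ?_⟩
        simp [z, ha, hbn, w]
    · have hex : ∃ k < n, a ∉ I.interpC (P k) := by push Not at hall; exact hall
      have g := g2 hex
      refine ⟨fun h => absurd (fun k hk => h k (by omega)) hall, fun _ => ?_⟩
      rw [i2 hex]
      by_cases ha : a ∈ I.interpC (P n)
      · simp [ha, g.2 ha]; ring
      · have hbn : b ∉ I.interpC (P n) := by tauto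
        simp [ha, hbn]

theorem Deast_step (I : Interp NC NR) (n : ℕ) (X Y : ℕ → NC) (r : NR) (a b : I.Δ)
    (h : a ∈ I.sem (Deast n X Y r)) (hab : (a, b) ∈ I.interpR r) :
    (posVal I n X b : ZMod (2 ^ n)) = (posVal I n X a : ZMod (2 ^ n)) + 1 ∧
    posVal I n Y b = posVal I n Y a := by
  simp only [Deast, Interp.sem, Set.mem_inter_iff, mem_bigI, mem_bigU, mem_impl,
    Set.mem_compl_iff, Set.mem_ofPred_eq, Interp.roleSem] at h
  obtain ⟨h1, h2, h3⟩ := h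
  have hi := posVal_incr I X a b n
    (fun k hk hj => by
      have := h1 k hk hj
      have u := fun t => this.1 t b hab
      have v := fun t => this.2 t b hab
      tauto)
    (fun k hk hj => by
      have := h2 k hk hj
      have u := fun t => this.1 t b hab
      have v := fun t => this.2 t b hab
      tauto)
  constructor
  · by_cases hall : ∀ k < n, a ∈ I.interpC (X k)
    · rw [hi.1 hall]
      have := (posVal_bound I X a n).2.2 hall
      have h' : ((posVal I n X a + 1 : ℕ) : ZMod (2 ^ n)) = 0 := by
        rw [this]; exact ZMod.natCast_self _
      push_cast at h'
      rw [h']; simp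
    · rw [hi.2 (by push Not at hall; exact hall)]; push_cast; rfl
  · unfold posVal
    refine Finset.sum_congr rfl fun k hk => ?_
    have := h3 k (Finset.mem_range.1 hk)
    have u := fun t => this.1 t b hab
    have v := fun t => this.2 t b hab
    by_cases ha : a ∈ I.interpC (Y k)
    · simp [ha, u ha]
    · simp [ha, v ha]

theorem posVal_neg_one (I : Interp NC NR) (n : ℕ) (P : ℕ → NC) (a : I.Δ)
    (h : (posVal I n P a : ZMod (2 ^ n)) = -1) : ∀ k < n, a ∈ I.interpC (P k) := by
  obtain ⟨h1, h2⟩ := posVal_bound I P a n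
  rw [← h2]
  have : ((posVal I n P a + 1 : ℕ) : ZMod (2 ^ n)) = 0 := by push_cast; rw [h]; simp
  rw [ZMod.natCast_eq_zero_iff] at this
  exact le_antisymm h1 (Nat.le_of_dvd (Nat.succ_pos _) this)

theorem pred_unique (I : Interp NC NR) (r : NR) (b : I.Δ)
    (h : b ∈ I.sem (exactlyOne (.inv r))) :
    (∃ a, (a, b) ∈ I.interpR r) ∧
    ∀ a a', (a, b) ∈ I.interpR r → (a', b) ∈ I.interpR r → a = a' := by
  simp only [exactlyOne, Interp.sem, Set.mem_inter_iff, Set.mem_ofPred_eq, Interp.roleSem,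
    Set.mem_univ, and_true, Nat.cast_one, Set.one_le_encard_iff_nonempty,
    Set.encard_le_one_iff] at h
  exact ⟨h.1, fun a a' => h.2 a a'⟩

/-- In any model `I` of the CBox `C_n`, the map `pos : a ↦ (xpos a, ypos a)` is a
bijection onto `Z_{2^n} × Z_{2^n}`, and the `east`- resp. `north`-edges are exactly the
horizontal resp. vertical successor pairs; i.e. `(Δ^I, east^I, north^I)` is isomorphic
to the torus `U(2^n, 2^n)` with its successor relations. -/
theorem cn_defines_torus (n : ℕ) (hn : 1 ≤ n) (I : Interp TNC TNR)
    (hI : ∀ r ∈ Cn n TNC.X TNC.Y TNR.east TNR.north, I.satCR r) :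
    Function.Bijective
      (fun a : I.Δ =>
        ((posVal I n TNC.X a : ZMod (2 ^ n)), (posVal I n TNC.Y a : ZMod (2 ^ n)))) ∧
    ∀ a b : I.Δ,
      ((a, b) ∈ I.interpR TNR.east ↔
        (posVal I n TNC.X b ≡ posVal I n TNC.X a + 1 [MOD 2 ^ n] ∧
          posVal I n TNC.Y b = posVal I n TNC.Y a)) ∧
      ((a, b) ∈ I.interpR TNR.north ↔
        (posVal I n TNC.Y b ≡ posVal I n TNC.Y a + 1 [MOD 2 ^ n] ∧
          posVal I n TNC.X b = posVal I n TNC.X a)) := by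
  simp only [Cn, List.mem_cons, List.not_mem_nil, or_false, forall_eq_or_imp, forall_eq] at hI
  obtain ⟨e1, e2, e3, e4, -, e6, e7, e8⟩ := hI
  have e8' := sat_allCR I _ e8
  simp only [Interp.sem, Set.mem_inter_iff] at e8'
  have hlt : ∀ P : ℕ → TNC, ∀ a b : I.Δ,
      posVal I n P a = posVal I n P b ↔
        (posVal I n P a : ZMod (2 ^ n)) = (posVal I n P b : ZMod (2 ^ n)) := by
    intro P a b
    rw [ZMod.natCast_eq_natCast_iff]
    exact ⟨fun h => by rw [h], fun h => Nat.ModEq.eq_of_lt_of_lt h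
      (posVal_bound I P a n).1 (posVal_bound I P b n).1⟩
  have hmod : ∀ P : ℕ → TNC, ∀ a b : I.Δ,
      posVal I n P b ≡ posVal I n P a + 1 [MOD 2 ^ n] ↔
        (posVal I n P b : ZMod (2 ^ n)) = (posVal I n P a : ZMod (2 ^ n)) + 1 := by
    intro P a b
    rw [← ZMod.natCast_eq_natCast_iff]; push_cast; rfl
  have hex : ∀ r : TNR, I.satCR (allCR (.ex (.name r) .top)) →
      ∀ a, ∃ b, (a, b) ∈ I.interpR r := by
    intro r h a
    obtain ⟨b, hb, -⟩ := sat_allCR I _ h a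
    exact ⟨b, hb⟩
  simp only [Interp.satCR, Nat.cast_one, Set.encard_le_one_iff] at e7
  have hmax : ∀ a : I.Δ, (posVal I n TNC.X a : ZMod (2 ^ n)) = -1 →
      (posVal I n TNC.Y a : ZMod (2 ^ n)) = -1 → a ∈ I.sem (Cmax n TNC.X TNC.Y) := by
    intro a h1 h2
    simp only [Cmax, Interp.sem, Set.mem_inter_iff, mem_bigI]
    exact ⟨posVal_neg_one I n _ a h1, posVal_neg_one I n _ a h2⟩
  simp only [hlt, hmod]
  exact torus_abs (fun z : ZMod (2 ^ n) => ZMod.natCast_zmod_surjective z)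
    (fun a => (posVal I n TNC.X a : ZMod (2 ^ n))) (fun a => (posVal I n TNC.Y a : ZMod (2 ^ n)))
    (fun a b => (a, b) ∈ I.interpR TNR.east) (fun a b => (a, b) ∈ I.interpR TNR.north)
    (hex _ e1) (hex _ e2)
    (fun b => (pred_unique I _ b (sat_allCR I _ e3 b)).1)
    (fun b => (pred_unique I _ b (sat_allCR I _ e4 b)).1)
    (fun a a' b => (pred_unique I _ b (sat_allCR I _ e3 b)).2 a a')
    (fun a a' b => (pred_unique I _ b (sat_allCR I _ e4 b)).2 a a')
    (fun a b h => by
      have := Deast_step I n _ _ _ a b (e8' a).1 h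
      exact ⟨this.1, (hlt _ _ _).1 this.2⟩)
    (fun a b h => by
      have := Deast_step I n _ _ _ a b (e8' a).2 h
      exact ⟨this.1, (hlt _ _ _).1 this.2⟩)
    I.nonempty.some
    (fun a a' h1 h2 h3 h4 => e7 a a' (hmax a h1 h2) (hmax a' h3 h4))

end Stmt8
end

section
/- Let D = (D, H, V) be a domino system and w = w₀…w_{n−1} ∈ D* a word of length n. Define the ALCQI-CBox C(n,D,w) = C_n ∪ C_D ∪ C_w, where C_n is the CBox defining the 2^n × 2^n torus, C_D consists (for a fresh concept name C_d for each tile d ∈ D) of the cardinality restrictions (∀ ⨆_{d∈D} C_d), (∀ ⨅_{d∈D} ⨅_{d'∈D∖{d}} ¬(C_d ⊓ C_{d'})), (∀ ⨅_{d∈D} (C_d → ∀east.⨆_{(d,d')∈H} C_{d'})), and (∀ ⨅_{d∈D} (C_d → ∀north.⨆_{(d,d')∈V} C_{d'})), and C_w = {(∀ (C_{(i,0)} → C_{w_i})) | 0 ≤ i < n}. Then C(n,D,w) is satisfiable if and only if D tiles the torus U(2^n, 2^n) with initial condition w. -/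
namespace Stmt9

/-- the concept names `X₀, X₁, …` and `Y₀, Y₁, …` -/
inductive TNC : Type
  | X : ℕ → TNC
  | Y : ℕ → TNC

/-- the role names `east` and `north` -/
inductive TNR : Type
  | east : TNR
  | north : TNR

/-- roles: role names and their inverses -/
inductive Role (NR : Type) : Type
  | name : NR → Role NR
  | inv : NR → Role NR

/-- ALCQI-concepts (with ⊤ and ⊥) -/
inductive Concept (NC NR : Type) : Type
  | top : Concept NC NR
  | bot : Concept NC NR
  | atom : NC → Concept NC NR
  | neg : Concept NC NR → Concept NC NR
  | inter : Concept NC NR → Concept NC NR → Concept NC NR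
  | union : Concept NC NR → Concept NC NR → Concept NC NR
  | all : Role NR → Concept NC NR → Concept NC NR
  | ex : Role NR → Concept NC NR → Concept NC NR
  | atLeast : ℕ → Role NR → Concept NC NR → Concept NC NR
  | atMost : ℕ → Role NR → Concept NC NR → Concept NC NR

structure Interp (NC NR : Type) where
  Δ : Type
  nonempty : Nonempty Δ
  interpC : NC → Set Δ
  interpR : NR → Set (Δ × Δ)

variable {NC NR : Type}

def Interp.roleSem (I : Interp NC NR) : Role NR → Set (I.Δ × I.Δ)
  | .name R => I.interpR R
  | .inv R => {p | (p.2, p.1) ∈ I.interpR R}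

def Interp.sem (I : Interp NC NR) : Concept NC NR → Set I.Δ
  | .top => Set.univ
  | .bot => ∅
  | .atom A => I.interpC A
  | .neg C => (I.sem C)ᶜ
  | .inter C D => I.sem C ∩ I.sem D
  | .union C D => I.sem C ∪ I.sem D
  | .all r C => {x | ∀ y, (x, y) ∈ I.roleSem r → y ∈ I.sem C}
  | .ex r C => {x | ∃ y, (x, y) ∈ I.roleSem r ∧ y ∈ I.sem C}
  | .atLeast n r C => {x | (n : ℕ∞) ≤ {y | (x, y) ∈ I.roleSem r ∧ y ∈ I.sem C}.encard}
  | .atMost n r C => {x | {y | (x, y) ∈ I.roleSem r ∧ y ∈ I.sem C}.encard ≤ (n : ℕ∞)}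

/-- cardinality restrictions `(⩾ n C)` and `(⩽ n C)` -/
inductive CardRestriction (NC NR : Type) : Type
  | atLeast : ℕ → Concept NC NR → CardRestriction NC NR
  | atMost : ℕ → Concept NC NR → CardRestriction NC NR

def Interp.satCR (I : Interp NC NR) : CardRestriction NC NR → Prop
  | .atLeast n C => (n : ℕ∞) ≤ (I.sem C).encard
  | .atMost n C => (I.sem C).encard ≤ (n : ℕ∞)

/-- `C → D` abbreviates `¬C ⊔ D` -/
def impl (C D : Concept NC NR) : Concept NC NR := .union (.neg C) D

def bigI (l : List (Concept NC NR)) : Concept NC NR := l.foldr .inter .top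

def bigU (l : List (Concept NC NR)) : Concept NC NR := l.foldr .union .bot

/-- the concept `D_east`; `D_north = Deast n Y X north` -/
def Deast (n : ℕ) (X Y : ℕ → NC) (r : NR) : Concept NC NR :=
  .inter
    (bigI ((List.range n).map fun k =>
      impl (bigI ((List.range k).map fun j => .atom (X j)))
        (.inter (impl (.atom (X k)) (.all (.name r) (.neg (.atom (X k)))))
          (impl (.neg (.atom (X k))) (.all (.name r) (.atom (X k)))))))
    (.inter
      (bigI ((List.range n).map fun k =>
        impl (bigU ((List.range k).map fun j => .neg (.atom (X j))))
          (.inter (impl (.atom (X k)) (.all (.name r) (.atom (X k))))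
            (impl (.neg (.atom (X k))) (.all (.name r) (.neg (.atom (X k))))))))
      (bigI ((List.range n).map fun k =>
        .inter (impl (.atom (Y k)) (.all (.name r) (.atom (Y k))))
          (impl (.neg (.atom (Y k))) (.all (.name r) (.neg (.atom (Y k))))))))

def Czero (n : ℕ) (X Y : ℕ → NC) : Concept NC NR :=
  .inter (bigI ((List.range n).map fun k => .neg (.atom (X k))))
    (bigI ((List.range n).map fun k => .neg (.atom (Y k))))

def Cmax (n : ℕ) (X Y : ℕ → NC) : Concept NC NR :=
  .inter (bigI ((List.range n).map fun k => .atom (X k)))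
    (bigI ((List.range n).map fun k => .atom (Y k)))

/-- `(∀ C)` abbreviates `(⩽ 0 ¬C)` -/
def allCR (C : Concept NC NR) : CardRestriction NC NR := .atMost 0 (.neg C)

/-- `(= 1 r ⊤)` abbreviates `(⩾ 1 r ⊤) ⊓ (⩽ 1 r ⊤)` -/
def exactlyOne (r : Role NR) : Concept NC NR := .inter (.atLeast 1 r .top) (.atMost 1 r .top)

/-- the CBox `C_n` defining the `2^n × 2^n` torus -/
def Cn (n : ℕ) (X Y : ℕ → NC) (east north : NR) : List (CardRestriction NC NR) :=
  [allCR (.ex (.name east) .top),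
   allCR (.ex (.name north) .top),
   allCR (exactlyOne (.inv east)),
   allCR (exactlyOne (.inv north)),
   .atLeast 1 (Czero n X Y),
   .atLeast 1 (Cmax n X Y),
   .atMost 1 (Cmax n X Y),
   allCR (.inter (Deast n X Y east) (Deast n Y X north))]

section Domino

-- `T` is the (finite) set of tiles of the domino system
variable {T : Type} [Fintype T] [DecidableEq T]

/-- the bit-concept-names, living in the disjoint sum `TNC ⊕ T` so that the tile
names `C_d` (= `Sum.inr d`) are fresh -/
def aX (k : ℕ) : Concept (TNC ⊕ T) TNR := .atom (Sum.inl (TNC.X k))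

def aY (k : ℕ) : Concept (TNC ⊕ T) TNR := .atom (Sum.inl (TNC.Y k))

/-- the fresh concept name `C_d` for the tile `d` -/
def tile (d : T) : Concept (TNC ⊕ T) TNR := .atom (Sum.inr d)

/-- the CBox `C_D` of a domino system `D = (T, H, V)` -/
noncomputable def CD (H V : Finset (T × T)) : List (CardRestriction (TNC ⊕ T) TNR) :=
  [allCR (bigU ((Finset.univ : Finset T).toList.map tile)),
   allCR (bigI ((Finset.univ : Finset T).toList.map fun d =>
     bigI ((Finset.univ.erase d).toList.map fun d' => .neg (.inter (tile d) (tile d'))))),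
   allCR (bigI ((Finset.univ : Finset T).toList.map fun d =>
     impl (tile d) (.all (.name TNR.east)
       (bigU ((Finset.univ.filter fun d' => (d, d') ∈ H).toList.map tile))))),
   allCR (bigI ((Finset.univ : Finset T).toList.map fun d =>
     impl (tile d) (.all (.name TNR.north)
       (bigU ((Finset.univ.filter fun d' => (d, d') ∈ V).toList.map tile)))))]

/-- the concept `C_{(x,y)}` pinpointing the position `(x, y)` of the torus via the
bits of `x` and `y` -/
def Cpos (n x y : ℕ) : Concept (TNC ⊕ T) TNR :=
  .inter
    (bigI ((List.range n).map fun k =>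
      if Nat.testBit x k then aX k else .neg (aX (T := T) k)))
    (bigI ((List.range n).map fun k =>
      if Nat.testBit y k then aY k else .neg (aY (T := T) k)))

/-- the CBox `C_w` expressing the initial condition `w` -/
def Cw (n : ℕ) (w : Fin n → T) : List (CardRestriction (TNC ⊕ T) TNR) :=
  (List.finRange n).map fun i => allCR (impl (Cpos n i.val 0) (tile (w i)))

section Helpers

open Classical in
noncomputable def bval (n : ℕ) (f : ℕ → Prop) : ℕ :=
  ∑ k ∈ Finset.range n, if f k then 2 ^ k else 0

theorem bval_succ (n : ℕ) (f : ℕ → Prop) [Decidable (f n)] :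
    bval (n+1) f = bval n f + if f n then 2 ^ n else 0 := by
  unfold bval
  rw [Finset.sum_range_succ]
  congr

theorem bval_lt (n : ℕ) (f : ℕ → Prop) : bval n f < 2 ^ n := by
  classical
  induction n with
  | zero => simp [bval]
  | succ n ih => rw [bval_succ, pow_succ]; split_ifs <;> omega

theorem bval_inj {n : ℕ} {f g : ℕ → Prop} (h : bval n f = bval n g) :
    ∀ k < n, (f k ↔ g k) := by
  classical
  induction n with
  | zero => simp
  | succ n ih =>
    have h1 := bval_lt n f
    have h2 := bval_lt n g
    rw [bval_succ, bval_succ] at h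
    have h3 : bval n f = bval n g ∧ (f n ↔ g n) := by
      by_cases hf : f n <;> by_cases hg : g n <;> simp [hf, hg] at h ⊢ <;> omega
    intro k hk
    rcases Nat.lt_succ_iff_lt_or_eq.1 hk with hk | rfl
    · exact ih h3.1 k hk
    · exact h3.2

theorem bval_congr {n : ℕ} {f g : ℕ → Prop} (h : ∀ k < n, (f k ↔ g k)) :
    bval n f = bval n g := by
  unfold bval
  apply Finset.sum_congr rfl
  intro k hk
  have := h k (Finset.mem_range.1 hk)
  by_cases hg : g k
  · rw [if_pos hg, if_pos (this.2 hg)]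
  · rw [if_neg hg, if_neg (fun hf => hg (this.1 hf))]

theorem bval_testBit (n x : ℕ) : bval n (fun k => x.testBit k = true) = x % 2 ^ n := by
  induction n with
  | zero => simp [bval, Nat.mod_one]
  | succ n ih =>
    rw [bval_succ, ih, Nat.mod_pow_succ, Nat.testBit_eq_decide_div_mod_eq]
    rcases Nat.mod_two_eq_zero_or_one (x / 2 ^ n) with h | h <;> simp [h]

def DStep (n : ℕ) (f g : ℕ → Prop) : Prop :=
  ∀ k < n, ((∀ j < k, f j) → (g k ↔ ¬ f k)) ∧ ((∃ j < k, ¬ f j) → (g k ↔ f k))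

open Classical in
theorem DStep.val' {n : ℕ} {f g : ℕ → Prop} (h : DStep n f g) :
    bval n g + (if ∀ j < n, f j then 2 ^ n else 0) = bval n f + 1 := by
  induction n with
  | zero => simp [bval]
  | succ n ih =>
    have h0 : DStep n f g := fun k hk => h k (by omega)
    have h1 := ih h0
    have h2 := h n (by omega)
    rw [bval_succ, bval_succ]
    have h3 : (∀ j < n + 1, f j) ↔ (∀ j < n, f j) ∧ f n := by
      constructor
      · intro h; exact ⟨fun j hj => h j (by omega), h n (by omega)⟩
      · rintro ⟨a, b⟩ j hj
        rcases Nat.lt_succ_iff_lt_or_eq.1 hj with hk | rfl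
        · exact a j hk
        · exact b
    by_cases hA : ∀ j < n, f j
    · have h4 := h2.1 hA
      rw [if_pos hA] at h1
      by_cases hf : f n
      · rw [if_neg (by tauto), if_pos (h3.2 ⟨hA, hf⟩), if_pos hf, pow_succ]; omega
      · rw [if_pos (by tauto), if_neg (by tauto), if_neg hf]; omega
    · have h4 := h2.2 (by push Not at hA; exact hA)
      rw [if_neg hA] at h1
      rw [if_neg (show ¬ ∀ j < n + 1, f j by tauto)]
      by_cases hf : f n
      · rw [if_pos (by tauto), if_pos hf]; omega
      · rw [if_neg (by tauto), if_neg hf]; omega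

theorem DStep.val {n : ℕ} {f g : ℕ → Prop} (h : DStep n f g) :
    (bval n g : ZMod (2 ^ n)) = bval n f + 1 := by
  classical
  have h1 := congrArg (Nat.cast : ℕ → ZMod (2 ^ n)) h.val'
  push_cast at h1
  rw [← h1]
  split_ifs
  · have : ((2 ^ n : ℕ) : ZMod (2 ^ n)) = 0 := ZMod.natCast_self _
    push_cast at this
    simp [this]
  · simp

theorem cast_inj {n a b : ℕ} (ha : a < 2 ^ n) (hb : b < 2 ^ n)
    (h : (a : ZMod (2 ^ n)) = b) : a = b := by
  rw [ZMod.natCast_eq_natCast_iff'] at h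
  rwa [Nat.mod_eq_of_lt ha, Nat.mod_eq_of_lt hb] at h

theorem bval_zmod {n : ℕ} (a : ZMod (2 ^ n)) :
    bval n (fun k => a.val.testBit k = true) = a.val := by
  rw [bval_testBit, Nat.mod_eq_of_lt (ZMod.val_lt a)]

theorem DStep_zmod {n : ℕ} (a : ZMod (2 ^ n)) :
    DStep n (fun k => a.val.testBit k = true) (fun k => (a + 1).val.testBit k = true) := by
  set f : ℕ → Prop := fun k => a.val.testBit k = true with hf
  let g : ℕ → Prop := fun k => ((∀ j < k, f j) ∧ ¬ f k) ∨ ((∃ j < k, ¬ f j) ∧ f k)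
  have hg : DStep n f g := by
    intro k hk
    constructor
    · intro h
      have : ¬ ∃ j < k, ¬ f j := by push Not; exact h
      simp only [g]; tauto
    · intro h
      have : ¬ ∀ j < k, f j := by push Not; exact h
      simp only [g]; tauto
  have h1 := hg.val
  rw [hf, bval_zmod, ZMod.natCast_zmod_val] at h1
  have h2 : bval n g = bval n (fun k => (a + 1).val.testBit k = true) := by
    apply cast_inj (bval_lt _ _) (bval_lt _ _)
    rw [h1, bval_zmod, ZMod.natCast_zmod_val]
  have h3 := bval_inj h2
  intro k hk
  have := hg k hk
  have h4 := h3 k hk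
  beta_reduce
  rw [← h4]
  exact this

theorem mem_bigI (I : Interp NC NR) {α : Type} (l : List α) (F : α → Concept NC NR) (x : I.Δ) :
    x ∈ I.sem (bigI (l.map F)) ↔ ∀ c ∈ l, x ∈ I.sem (F c) := by
  induction l with
  | nil => simp [bigI, Interp.sem]
  | cons a l ih =>
    have : x ∈ I.sem (bigI ((a :: l).map F)) ↔ x ∈ I.sem (F a) ∧ x ∈ I.sem (bigI (l.map F)) :=
      Iff.rfl
    rw [this, ih]; simp

theorem mem_bigU (I : Interp NC NR) {α : Type} (l : List α) (F : α → Concept NC NR) (x : I.Δ) :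
    x ∈ I.sem (bigU (l.map F)) ↔ ∃ c ∈ l, x ∈ I.sem (F c) := by
  induction l with
  | nil => simp [bigU, Interp.sem]
  | cons a l ih =>
    have : x ∈ I.sem (bigU ((a :: l).map F)) ↔ x ∈ I.sem (F a) ∨ x ∈ I.sem (bigU (l.map F)) :=
      Iff.rfl
    rw [this, ih]; simp

theorem mem_impl (I : Interp NC NR) (C D : Concept NC NR) (x : I.Δ) :
    x ∈ I.sem (impl C D) ↔ (x ∈ I.sem C → x ∈ I.sem D) := by
  have : x ∈ I.sem (impl C D) ↔ (¬ x ∈ I.sem C) ∨ x ∈ I.sem D := Iff.rfl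
  rw [this]; tauto

theorem mem_inter (I : Interp NC NR) (C D : Concept NC NR) (x : I.Δ) :
    x ∈ I.sem (.inter C D) ↔ (x ∈ I.sem C ∧ x ∈ I.sem D) := Iff.rfl

theorem mem_neg (I : Interp NC NR) (C : Concept NC NR) (x : I.Δ) :
    x ∈ I.sem (.neg C) ↔ ¬ x ∈ I.sem C := Iff.rfl

theorem mem_atom (I : Interp NC NR) (A : NC) (x : I.Δ) :
    x ∈ I.sem (.atom A) ↔ x ∈ I.interpC A := Iff.rfl

theorem mem_all (I : Interp NC NR) (r : NR) (C : Concept NC NR) (x : I.Δ) :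
    x ∈ I.sem (.all (.name r) C) ↔ ∀ y, (x, y) ∈ I.interpR r → y ∈ I.sem C := Iff.rfl

theorem mem_ex (I : Interp NC NR) (r : NR) (x : I.Δ) :
    x ∈ I.sem (.ex (.name r) .top) ↔ ∃ y, (x, y) ∈ I.interpR r := by
  have : x ∈ I.sem (.ex (.name r) .top) ↔ ∃ y, (x, y) ∈ I.interpR r ∧ y ∈ Set.univ := Iff.rfl
  rw [this]; simp

theorem sat_allCR (I : Interp NC NR) (C : Concept NC NR) :
    I.satCR (allCR C) ↔ ∀ x, x ∈ I.sem C := by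
  have : I.satCR (allCR C) ↔ ((I.sem C)ᶜ).encard ≤ ((0 : ℕ) : ℕ∞) := Iff.rfl
  rw [this]
  simp [Set.eq_univ_iff_forall]

theorem mem_exactlyOne (I : Interp NC NR) (r : NR) (x : I.Δ) :
    x ∈ I.sem (exactlyOne (.inv r)) ↔ ∃! y, (y, x) ∈ I.interpR r := by
  have : x ∈ I.sem (exactlyOne (.inv r)) ↔
    ((1 : ℕ) : ℕ∞) ≤ {y | (y, x) ∈ I.interpR r ∧ y ∈ Set.univ}.encard ∧
    {y | (y, x) ∈ I.interpR r ∧ y ∈ Set.univ}.encard ≤ ((1 : ℕ) : ℕ∞) := Iff.rfl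
  rw [this, Nat.cast_one, Set.one_le_encard_iff_nonempty, Set.encard_le_one_iff]
  simp only [Set.mem_univ, and_true, Set.mem_ofPred_eq]
  constructor
  · rintro ⟨⟨y, hy⟩, h⟩
    exact ⟨y, hy, fun z hz => h z y hz hy⟩
  · rintro ⟨y, hy, h⟩
    exact ⟨⟨y, hy⟩, fun a b ha hb => (h a ha).trans (h b hb).symm⟩

theorem sat_atLeast1 (I : Interp NC NR) (C : Concept NC NR) :
    I.satCR (.atLeast 1 C) ↔ ∃ x, x ∈ I.sem C := by
  have : I.satCR (.atLeast 1 C) ↔ ((1 : ℕ) : ℕ∞) ≤ (I.sem C).encard := Iff.rfl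
  rw [this, Nat.cast_one, Set.one_le_encard_iff_nonempty]; rfl

theorem sat_atMost1 (I : Interp NC NR) (C : Concept NC NR) :
    I.satCR (.atMost 1 C) ↔ ∀ x y, x ∈ I.sem C → y ∈ I.sem C → x = y := by
  have : I.satCR (.atMost 1 C) ↔ (I.sem C).encard ≤ ((1 : ℕ) : ℕ∞) := Iff.rfl
  rw [this, Nat.cast_one, Set.encard_le_one_iff]

theorem mem_Deast (I : Interp NC NR) (n : ℕ) (X Y : ℕ → NC) (r : NR) (a : I.Δ) :
    a ∈ I.sem (Deast n X Y r) ↔ ∀ b, (a, b) ∈ I.interpR r →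
      DStep n (fun k => a ∈ I.interpC (X k)) (fun k => b ∈ I.interpC (X k)) ∧
      ∀ k < n, (b ∈ I.interpC (Y k) ↔ a ∈ I.interpC (Y k)) := by
  simp only [Deast, mem_inter, mem_bigI, mem_bigU, mem_impl, mem_neg, mem_atom, mem_all,
    List.mem_range, DStep]
  constructor
  · rintro ⟨h1, h2, h3⟩ b hb
    refine ⟨fun k hk => ⟨fun h => ?_, fun h => ?_⟩, fun k hk => ?_⟩
    · have u := (h1 k hk h).1; have v := (h1 k hk h).2
      by_cases hx : a ∈ I.interpC (X k)
      · have := u hx b hb; tauto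
      · have := v hx b hb; tauto
    · have u := (h2 k hk h).1; have v := (h2 k hk h).2
      by_cases hx : a ∈ I.interpC (X k)
      · have := u hx b hb; tauto
      · have := v hx b hb; tauto
    · have u := (h3 k hk).1; have v := (h3 k hk).2
      by_cases hx : a ∈ I.interpC (Y k)
      · have := u hx b hb; tauto
      · have := v hx b hb; tauto
  · intro h
    refine ⟨fun k hk hc => ⟨fun hx b hb => ?_, fun hx b hb => ?_⟩,
      fun k hk hc => ⟨fun hx b hb => ?_, fun hx b hb => ?_⟩,
      fun k hk => ⟨fun hx b hb => ?_, fun hx b hb => ?_⟩⟩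
    · have := ((h b hb).1 k hk).1 hc; tauto
    · have := ((h b hb).1 k hk).1 hc; tauto
    · have := ((h b hb).1 k hk).2 hc; tauto
    · have := ((h b hb).1 k hk).2 hc; tauto
    · have := (h b hb).2 k hk; tauto
    · have := (h b hb).2 k hk; tauto

theorem mem_Cpos {T : Type} (I : Interp (TNC ⊕ T) TNR) (n x y : ℕ) (a : I.Δ) :
    a ∈ I.sem (Cpos n x y) ↔
      (∀ k < n, (a ∈ I.interpC (.inl (.X k)) ↔ x.testBit k = true)) ∧
      (∀ k < n, (a ∈ I.interpC (.inl (.Y k)) ↔ y.testBit k = true)) := by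
  simp only [Cpos, mem_inter, mem_bigI, List.mem_range]
  apply and_congr
  · refine forall_congr' fun k => imp_congr_right fun _ => ?_
    cases x.testBit k <;> simp [aX, mem_neg, mem_atom]
  · refine forall_congr' fun k => imp_congr_right fun _ => ?_
    cases y.testBit k <;> simp [aY, mem_neg, mem_atom]

/-- the whole CBox, semantically -/
theorem sat_iff {T : Type} [Fintype T] [DecidableEq T] (n : ℕ) (H V : Finset (T × T))
    (w : Fin n → T) (I : Interp (TNC ⊕ T) TNR) :
    (∀ r ∈ Cn n (fun k => Sum.inl (TNC.X k)) (fun k => Sum.inl (TNC.Y k))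
          TNR.east TNR.north ++ CD H V ++ Cw n w, I.satCR r) ↔
    ((∀ a, ∃ b, (a, b) ∈ I.interpR .east) ∧ (∀ a, ∃ b, (a, b) ∈ I.interpR .north) ∧
     (∀ a, ∃! b, (b, a) ∈ I.interpR .east) ∧ (∀ a, ∃! b, (b, a) ∈ I.interpR .north) ∧
     (∃ a, (∀ k < n, a ∉ I.interpC (.inl (.X k))) ∧ ∀ k < n, a ∉ I.interpC (.inl (.Y k))) ∧
     (∃ a, (∀ k < n, a ∈ I.interpC (.inl (.X k))) ∧ ∀ k < n, a ∈ I.interpC (.inl (.Y k))) ∧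
     (∀ a b, ((∀ k < n, a ∈ I.interpC (.inl (.X k))) ∧ ∀ k < n, a ∈ I.interpC (.inl (.Y k))) →
       ((∀ k < n, b ∈ I.interpC (.inl (.X k))) ∧ ∀ k < n, b ∈ I.interpC (.inl (.Y k))) → a = b) ∧
     (∀ a, (∀ b, (a, b) ∈ I.interpR .east →
      DStep n (fun k => a ∈ I.interpC (.inl (.X k))) (fun k => b ∈ I.interpC (.inl (.X k))) ∧
      ∀ k < n, (b ∈ I.interpC (.inl (.Y k)) ↔ a ∈ I.interpC (.inl (.Y k)))) ∧
      (∀ b, (a, b) ∈ I.interpR .north →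
      DStep n (fun k => a ∈ I.interpC (.inl (.Y k))) (fun k => b ∈ I.interpC (.inl (.Y k))) ∧
      ∀ k < n, (b ∈ I.interpC (.inl (.X k)) ↔ a ∈ I.interpC (.inl (.X k)))))) ∧
    ((∀ a, ∃ d, a ∈ I.interpC (.inr d)) ∧
     (∀ a d d', d' ≠ d → ¬ (a ∈ I.interpC (.inr d) ∧ a ∈ I.interpC (.inr d'))) ∧
     (∀ a d, a ∈ I.interpC (.inr d) → ∀ b, (a, b) ∈ I.interpR .east →
        ∃ d', (d, d') ∈ H ∧ b ∈ I.interpC (.inr d')) ∧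
     (∀ a d, a ∈ I.interpC (.inr d) → ∀ b, (a, b) ∈ I.interpR .north →
        ∃ d', (d, d') ∈ V ∧ b ∈ I.interpC (.inr d'))) ∧
    (∀ i : Fin n, ∀ a,
      ((∀ k < n, (a ∈ I.interpC (.inl (.X k)) ↔ (i : ℕ).testBit k = true)) ∧
      (∀ k < n, (a ∈ I.interpC (.inl (.Y k)) ↔ (0 : ℕ).testBit k = true))) →
      a ∈ I.interpC (.inr (w i))) := by
  simp only [List.forall_mem_append, Cn, CD, Cw, List.forall_mem_cons, List.forall_mem_map,
    sat_allCR, sat_atLeast1, sat_atMost1, mem_ex, mem_exactlyOne, Czero, Cmax, mem_inter,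
    mem_bigI, mem_bigU, mem_impl, mem_neg, mem_atom, mem_all, List.mem_range, mem_Deast,
    mem_Cpos, tile, Finset.mem_toList, Finset.mem_univ, Finset.mem_erase, Finset.mem_filter,
    true_and, and_true, true_imp_iff, List.mem_finRange, List.not_mem_nil,
    false_imp_iff, implies_true, and_assoc]

end Helpers

/-- For a domino system `D = (T, H, V)` and a word `w` of length `n`, the CBox
`C(n,D,w) = C_n ∪ C_D ∪ C_w` is satisfiable iff `D` tiles the torus
`U(2^n, 2^n) = Z_{2^n} × Z_{2^n}` with initial condition `w`. -/
theorem domino_reduction (n : ℕ) (H V : Finset (T × T)) (w : Fin n → T) :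
    (∃ I : Interp (TNC ⊕ T) TNR,
      ∀ r ∈ Cn n (fun k => Sum.inl (TNC.X k)) (fun k => Sum.inl (TNC.Y k))
          TNR.east TNR.north ++ CD H V ++ Cw n w,
        I.satCR r) ↔
    (∃ τ : ZMod (2 ^ n) × ZMod (2 ^ n) → T,
      (∀ p : ZMod (2 ^ n) × ZMod (2 ^ n), (τ p, τ (p.1 + 1, p.2)) ∈ H) ∧
      (∀ p : ZMod (2 ^ n) × ZMod (2 ^ n), (τ p, τ (p.1, p.2 + 1)) ∈ V) ∧
      (∀ i : Fin n, τ (((i : ℕ) : ZMod (2 ^ n)), 0) = w i)) := by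
  constructor
  · rintro ⟨I, hI⟩
    rw [sat_iff] at hI
    obtain ⟨⟨he, hn, hei, hni, -, -, hmax, hD⟩, ⟨ht, hdisj, hH, hV⟩, hw⟩ := hI
    let px : I.Δ → ZMod (2 ^ n) := fun a => bval n (fun k => a ∈ I.interpC (.inl (.X k)))
    let py : I.Δ → ZMod (2 ^ n) := fun a => bval n (fun k => a ∈ I.interpC (.inl (.Y k)))
    have hE : ∀ a b, (a, b) ∈ I.interpR .east → px b = px a + 1 ∧ py b = py a := by
      intro a b h
      obtain ⟨h1, h2⟩ := (hD a).1 b h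
      exact ⟨h1.val, congrArg (Nat.cast : ℕ → ZMod (2 ^ n)) (bval_congr h2)⟩
    have hN : ∀ a b, (a, b) ∈ I.interpR .north → px b = px a ∧ py b = py a + 1 := by
      intro a b h
      obtain ⟨h1, h2⟩ := (hD a).2 b h
      exact ⟨congrArg (Nat.cast : ℕ → ZMod (2 ^ n)) (bval_congr h2), h1.val⟩
    choose se hse using he
    choose sn hsn using hn
    have sei : Function.Injective se := by
      intro a b hab
      exact (hei (se a)).unique (hse a) (hab ▸ hse b)
    have sni : Function.Injective sn := by
      intro a b hab
      exact (hni (sn a)).unique (hsn a) (hab ▸ hsn b)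
    have iE : ∀ (k : ℕ) a, px (se^[k] a) = px a + k ∧ py (se^[k] a) = py a := by
      intro k a
      induction k with
      | zero => simp
      | succ k ih =>
        rw [Function.iterate_succ_apply']
        have := hE _ _ (hse (se^[k] a))
        rw [this.1, this.2, ih.1, ih.2]
        push_cast
        exact ⟨by ring, rfl⟩
    have iN : ∀ (k : ℕ) a, px (sn^[k] a) = px a ∧ py (sn^[k] a) = py a + k := by
      intro k a
      induction k with
      | zero => simp
      | succ k ih =>
        rw [Function.iterate_succ_apply']
        have := hN _ _ (hsn (sn^[k] a))
        rw [this.1, this.2, ih.1, ih.2]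
        push_cast
        exact ⟨rfl, by ring⟩
    have walk : ∀ a (u v : ZMod (2 ^ n)),
        px (sn^[(v - py a).val] (se^[(u - px a).val] a)) = u ∧
        py (sn^[(v - py a).val] (se^[(u - px a).val] a)) = v := by
      intro a u v
      have h1 := iN (v - py a).val (se^[(u - px a).val] a)
      have h2 := iE (u - px a).val a
      rw [h1.1, h1.2, h2.1, h2.2, ZMod.natCast_zmod_val, ZMod.natCast_zmod_val]
      constructor <;> ring
    have bits : ∀ f g : ℕ → Prop, (bval n f : ZMod (2 ^ n)) = bval n g → ∀ k < n, (f k ↔ g k) :=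
      fun f g h => bval_inj (cast_inj (bval_lt _ _) (bval_lt _ _) h)
    have inj : ∀ a b, px a = px b → py a = py b → a = b := by
      intro a b h1 h2
      let M : ZMod (2 ^ n) := bval n (fun _ => True)
      have ha := walk a M M
      have hb := walk b M M
      have key : ∀ c, px c = M → py c = M → ((∀ k < n, c ∈ I.interpC (.inl (.X k))) ∧
          ∀ k < n, c ∈ I.interpC (.inl (.Y k))) := by
        intro c hx hy
        exact ⟨fun k hk => (bits _ _ hx k hk).2 trivial, fun k hk => (bits _ _ hy k hk).2 trivial⟩
      have := hmax _ _ (key _ ha.1 ha.2) (key _ hb.1 hb.2)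
      rw [h1, h2] at this
      exact sei.iterate _ (sni.iterate _ this)
    obtain ⟨a0⟩ := I.nonempty
    have ex : ∀ p : ZMod (2 ^ n) × ZMod (2 ^ n), ∃ a, px a = p.1 ∧ py a = p.2 :=
      fun p => ⟨_, walk a0 p.1 p.2⟩
    choose e hex hey using ex
    choose t ht using ht
    have tu : ∀ a d, a ∈ I.interpC (.inr d) → t a = d := by
      intro a d h
      by_contra hne
      exact hdisj a d (t a) hne ⟨h, ht a⟩
    refine ⟨fun p => t (e p), fun p => ?_, fun p => ?_, fun i => ?_⟩
    · have h1 : se (e p) = e (p.1 + 1, p.2) := by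
        have := hE _ _ (hse (e p))
        apply inj
        · rw [this.1, hex, hex]
        · rw [this.2, hey, hey]
      obtain ⟨d', hd, hb⟩ := hH (e p) _ (ht _) _ (hse (e p))
      rw [h1] at hb
      simp only [tu _ _ hb, hd]
    · have h1 : sn (e p) = e (p.1, p.2 + 1) := by
        have := hN _ _ (hsn (e p))
        apply inj
        · rw [this.1, hex, hex]
        · rw [this.2, hey, hey]
      obtain ⟨d', hd, hb⟩ := hV (e p) _ (ht _) _ (hsn (e p))
      rw [h1] at hb
      simp only [tu _ _ hb, hd]
    · apply tu
      apply hw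
      constructor
      · apply bits _ (fun k => (i : ℕ).testBit k = true)
        rw [bval_testBit, ZMod.natCast_mod]
        exact hex (_, 0)
      · apply bits _ (fun k => (0 : ℕ).testBit k = true)
        rw [bval_testBit, ZMod.natCast_mod]
        simpa using hey ((i : ℕ), 0)
  · rintro ⟨τ, hH, hV, hw⟩
    let I : Interp (TNC ⊕ T) TNR :=
      { Δ := ZMod (2 ^ n) × ZMod (2 ^ n)
        nonempty := ⟨(0, 0)⟩
        interpC := fun A => match A with
          | .inl (.X k) => {p | p.1.val.testBit k = true}
          | .inl (.Y k) => {p | p.2.val.testBit k = true}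
          | .inr d => {p | τ p = d}
        interpR := fun r => match r with
          | .east => {q | q.2 = (q.1.1 + 1, q.1.2)}
          | .north => {q | q.2 = (q.1.1, q.1.2 + 1)} }
    have eqz : ∀ (a b : ZMod (2 ^ n)),
        (∀ k < n, (a.val.testBit k = true ↔ b.val.testBit k = true)) → a = b := by
      intro a b h
      have := bval_congr h
      rw [bval_zmod, bval_zmod] at this
      exact ZMod.val_injective _ this
    have hM : ∀ k < n, ((bval n (fun _ => True) : ZMod (2 ^ n))).val.testBit k = true := by
      have : bval n (fun k =>
          ((bval n (fun _ => True) : ZMod (2 ^ n))).val.testBit k = true) =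
          bval n (fun _ => True) := by
        rw [bval_zmod, ZMod.val_natCast, Nat.mod_eq_of_lt (bval_lt _ _)]
      intro k hk
      exact (bval_inj this k hk).2 trivial
    refine ⟨I, (sat_iff n H V w I).2 ⟨⟨?_, ?_, ?_, ?_, ?_, ?_, ?_, ?_⟩, ⟨?_, ?_, ?_, ?_⟩, ?_⟩⟩
    · exact fun a => ⟨(a.1 + 1, a.2), rfl⟩
    · exact fun a => ⟨(a.1, a.2 + 1), rfl⟩
    · rintro ⟨x, y⟩
      refine ⟨(x - 1, y), ?_, ?_⟩
      · change (x, y) = (x - 1 + 1, y)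
        simp
      · rintro ⟨u, v⟩ h
        have h : (x, y) = (u + 1, v) := h
        obtain ⟨rfl, rfl⟩ := Prod.mk.inj h
        simp
    · rintro ⟨x, y⟩
      refine ⟨(x, y - 1), ?_, ?_⟩
      · change (x, y) = (x, y - 1 + 1)
        simp
      · rintro ⟨u, v⟩ h
        have h : (x, y) = (u, v + 1) := h
        obtain ⟨rfl, rfl⟩ := Prod.mk.inj h
        simp
    · exact ⟨(0, 0), fun k _ => by simp [I], fun k _ => by simp [I]⟩
    · exact ⟨(bval n (fun _ => True), bval n (fun _ => True)), hM, hM⟩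
    · rintro ⟨x, y⟩ ⟨u, v⟩ ⟨h1, h2⟩ ⟨h3, h4⟩
      exact Prod.ext (eqz _ _ fun k hk => iff_of_true (h1 k hk) (h3 k hk))
        (eqz _ _ fun k hk => iff_of_true (h2 k hk) (h4 k hk))
    · intro a
      constructor
      · intro b hb
        obtain rfl : b = (a.1 + 1, a.2) := hb
        exact ⟨DStep_zmod a.1, fun k _ => Iff.rfl⟩
      · intro b hb
        obtain rfl : b = (a.1, a.2 + 1) := hb
        exact ⟨DStep_zmod a.2, fun k _ => Iff.rfl⟩
    · exact fun a => ⟨τ a, rfl⟩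
    · rintro a d d' hne ⟨h1, h2⟩
      have h1 : τ a = d := h1
      have h2 : τ a = d' := h2
      exact hne (h2.symm.trans h1)
    · intro a d hd b hb
      obtain rfl : b = (a.1 + 1, a.2) := hb
      obtain rfl : τ a = d := hd
      exact ⟨_, hH a, rfl⟩
    · intro a d hd b hb
      obtain rfl : b = (a.1, a.2 + 1) := hb
      obtain rfl : τ a = d := hd
      exact ⟨_, hV a, rfl⟩
    · rintro i ⟨x, y⟩ ⟨h1, h2⟩
      change τ (x, y) = w i
      have e1 : x = ((i : ℕ) : ZMod (2 ^ n)) := by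
        have h : bval n (fun k => x.val.testBit k = true) =
          bval n (fun k => (i : ℕ).testBit k = true) := bval_congr h1
        rw [bval_zmod, bval_testBit] at h
        have := congrArg (Nat.cast : ℕ → ZMod (2 ^ n)) h
        rwa [ZMod.natCast_zmod_val, ZMod.natCast_mod] at this
      have e2 : y = 0 := by
        have h : bval n (fun k => y.val.testBit k = true) =
          bval n (fun k => (0 : ℕ).testBit k = true) := bval_congr h2
        rw [bval_zmod, bval_testBit] at h
        have := congrArg (Nat.cast : ℕ → ZMod (2 ^ n)) h
        rwa [ZMod.natCast_zmod_val, ZMod.natCast_mod, Nat.cast_zero] at this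
      rw [e1, e2]
      exact hw i

end Domino

end Stmt9
end

section
/- Let C = {(⋈₁ n₁ C₁), …, (⋈ₖ nₖ Cₖ)} be a CBox over ALCQI-concepts (each ⋈ᵢ ∈ {≥, ≤}) and let R be a role name not occurring in C. Then the ALCQIB-concept C_C = (⩽ 0 ¬R ⊤) ⊓ ⨅_{i=1}^{k} (⋈ᵢ nᵢ R Cᵢ) is satisfiable if and only if the CBox C is satisfiable. -/
namespace Stmt11

/-- roles: role names and their inverses -/
inductive Role (NR : Type) : Type
  | name : NR → Role NR
  | inv : NR → Role NR

/-- Boolean role expressions, built from (possibly inverse) roles with ⊓, ⊔ and ¬ -/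
inductive RoleExpr (NR : Type) : Type
  | of : Role NR → RoleExpr NR
  | inter : RoleExpr NR → RoleExpr NR → RoleExpr NR
  | union : RoleExpr NR → RoleExpr NR → RoleExpr NR
  | compl : RoleExpr NR → RoleExpr NR

/-- ALCQIB-concepts: number restrictions (and value restrictions) may use arbitrary
Boolean role expressions; `top` is ⊤ -/
inductive BConcept (NC NR : Type) : Type
  | top : BConcept NC NR
  | atom : NC → BConcept NC NR
  | neg : BConcept NC NR → BConcept NC NR
  | inter : BConcept NC NR → BConcept NC NR → BConcept NC NR
  | union : BConcept NC NR → BConcept NC NR → BConcept NC NR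
  | all : RoleExpr NR → BConcept NC NR → BConcept NC NR
  | ex : RoleExpr NR → BConcept NC NR → BConcept NC NR
  | atLeast : ℕ → RoleExpr NR → BConcept NC NR → BConcept NC NR
  | atMost : ℕ → RoleExpr NR → BConcept NC NR → BConcept NC NR

/-- ALCQI-concepts: the fragment whose role expressions are single (possibly inverse)
roles -/
inductive QConcept (NC NR : Type) : Type
  | atom : NC → QConcept NC NR
  | neg : QConcept NC NR → QConcept NC NR
  | inter : QConcept NC NR → QConcept NC NR → QConcept NC NR
  | union : QConcept NC NR → QConcept NC NR → QConcept NC NR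
  | all : Role NR → QConcept NC NR → QConcept NC NR
  | ex : Role NR → QConcept NC NR → QConcept NC NR
  | atLeast : ℕ → Role NR → QConcept NC NR → QConcept NC NR
  | atMost : ℕ → Role NR → QConcept NC NR → QConcept NC NR

variable {NC NR : Type}

/-- the embedding of ALCQI into ALCQIB -/
def QConcept.toB : QConcept NC NR → BConcept NC NR
  | .atom A => .atom A
  | .neg C => .neg C.toB
  | .inter C D => .inter C.toB D.toB
  | .union C D => .union C.toB D.toB
  | .all r C => .all (.of r) C.toB
  | .ex r C => .ex (.of r) C.toB
  | .atLeast n r C => .atLeast n (.of r) C.toB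
  | .atMost n r C => .atMost n (.of r) C.toB

structure Interp (NC NR : Type) where
  Δ : Type
  nonempty : Nonempty Δ
  interpC : NC → Set Δ
  interpR : NR → Set (Δ × Δ)

def Interp.roleSem (I : Interp NC NR) : Role NR → Set (I.Δ × I.Δ)
  | .name R => I.interpR R
  | .inv R => {p | (p.2, p.1) ∈ I.interpR R}

def Interp.reSem (I : Interp NC NR) : RoleExpr NR → Set (I.Δ × I.Δ)
  | .of r => I.roleSem r
  | .inter a b => I.reSem a ∩ I.reSem b
  | .union a b => I.reSem a ∪ I.reSem b
  | .compl a => (I.reSem a)ᶜ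

def Interp.bsem (I : Interp NC NR) : BConcept NC NR → Set I.Δ
  | .top => Set.univ
  | .atom A => I.interpC A
  | .neg C => (I.bsem C)ᶜ
  | .inter C D => I.bsem C ∩ I.bsem D
  | .union C D => I.bsem C ∪ I.bsem D
  | .all ω C => {x | ∀ y, (x, y) ∈ I.reSem ω → y ∈ I.bsem C}
  | .ex ω C => {x | ∃ y, (x, y) ∈ I.reSem ω ∧ y ∈ I.bsem C}
  | .atLeast n ω C => {x | (n : ℕ∞) ≤ {y | (x, y) ∈ I.reSem ω ∧ y ∈ I.bsem C}.encard}
  | .atMost n ω C => {x | {y | (x, y) ∈ I.reSem ω ∧ y ∈ I.bsem C}.encard ≤ (n : ℕ∞)}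

def Interp.qsem (I : Interp NC NR) : QConcept NC NR → Set I.Δ
  | .atom A => I.interpC A
  | .neg C => (I.qsem C)ᶜ
  | .inter C D => I.qsem C ∩ I.qsem D
  | .union C D => I.qsem C ∪ I.qsem D
  | .all r C => {x | ∀ y, (x, y) ∈ I.roleSem r → y ∈ I.qsem C}
  | .ex r C => {x | ∃ y, (x, y) ∈ I.roleSem r ∧ y ∈ I.qsem C}
  | .atLeast n r C => {x | (n : ℕ∞) ≤ {y | (x, y) ∈ I.roleSem r ∧ y ∈ I.qsem C}.encard}
  | .atMost n r C => {x | {y | (x, y) ∈ I.roleSem r ∧ y ∈ I.qsem C}.encard ≤ (n : ℕ∞)}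

/-- cardinality restrictions over ALCQI-concepts -/
inductive CardRestriction (NC NR : Type) : Type
  | atLeast : ℕ → QConcept NC NR → CardRestriction NC NR
  | atMost : ℕ → QConcept NC NR → CardRestriction NC NR

def Interp.satCR (I : Interp NC NR) : CardRestriction NC NR → Prop
  | .atLeast n C => (n : ℕ∞) ≤ (I.qsem C).encard
  | .atMost n C => (I.qsem C).encard ≤ (n : ℕ∞)

/-- the role name `R` occurs (possibly inverted) in the ALCQI-concept -/
def roleNameOccurs (R : NR) : QConcept NC NR → Prop
  | .atom _ => False
  | .neg C => roleNameOccurs R C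
  | .inter C D => roleNameOccurs R C ∨ roleNameOccurs R D
  | .union C D => roleNameOccurs R C ∨ roleNameOccurs R D
  | .all r C => r = .name R ∨ r = .inv R ∨ roleNameOccurs R C
  | .ex r C => r = .name R ∨ r = .inv R ∨ roleNameOccurs R C
  | .atLeast _ r C => r = .name R ∨ r = .inv R ∨ roleNameOccurs R C
  | .atMost _ r C => r = .name R ∨ r = .inv R ∨ roleNameOccurs R C

/-- the role name `R` occurs in the cardinality restriction -/
def crUsesRole (R : NR) : CardRestriction NC NR → Prop
  | .atLeast _ C => roleNameOccurs R C
  | .atMost _ C => roleNameOccurs R C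

/-- the conjunct `(⋈ᵢ nᵢ R Cᵢ)` of `C_C` corresponding to a cardinality restriction -/
def restrictionConcept (R : NR) : CardRestriction NC NR → BConcept NC NR
  | .atLeast n C => .atLeast n (.of (.name R)) C.toB
  | .atMost n C => .atMost n (.of (.name R)) C.toB

/-- conjunction of a list of ALCQIB-concepts -/
def bigIB : List (BConcept NC NR) → BConcept NC NR
  | [] => .top
  | [C] => C
  | C :: D :: l => .inter C (bigIB (D :: l))

/-- `C_C = (⩽ 0 ¬R ⊤) ⊓ ⨅ᵢ (⋈ᵢ nᵢ R Cᵢ)` -/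
def CC (R : NR) (L : List (CardRestriction NC NR)) : BConcept NC NR :=
  .inter (.atMost 0 (.compl (.of (.name R))) .top) (bigIB (L.map (restrictionConcept R)))

theorem bsem_toB (I : Interp NC NR) (C : QConcept NC NR) : I.bsem C.toB = I.qsem C := by
  induction C <;> simp_all [QConcept.toB, Interp.bsem, Interp.qsem, Interp.reSem]

theorem mem_bigIB (I : Interp NC NR) (x : I.Δ) (l : List (BConcept NC NR)) :
    x ∈ I.bsem (bigIB l) ↔ ∀ C ∈ l, x ∈ I.bsem C := by
  induction l with
  | nil => simp [bigIB, Interp.bsem]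
  | cons C l ih =>
    cases l with
    | nil => simp [bigIB]
    | cons D l =>
      rw [bigIB, Interp.bsem, Set.mem_inter_iff, ih, List.forall_mem_cons (a := C)]

/-- make `R` universal -/
def extI (I : Interp NC NR) (R : NR) : Interp NC NR where
  Δ := I.Δ
  nonempty := I.nonempty
  interpC := I.interpC
  interpR := fun S => {p | S = R ∨ p ∈ I.interpR S}

theorem extI_role (I : Interp NC NR) (R : NR) (r : Role NR) (h1 : r ≠ .name R)
    (h2 : r ≠ .inv R) : (extI I R).roleSem r = I.roleSem r := by
  cases r with
  | name S =>
    have : S ≠ R := fun h => h1 (by rw [h])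
    simp [Interp.roleSem, extI, this]
  | inv S =>
    have : S ≠ R := fun h => h2 (by rw [h])
    simp [Interp.roleSem, extI, this]
    rfl

theorem extI_qsem (I : Interp NC NR) (R : NR) (C : QConcept NC NR)
    (h : ¬ roleNameOccurs R C) : (extI I R).qsem C = I.qsem C := by
  induction C with
  | atom A => rfl
  | neg C ih => 
    have h := ih h
    simp only [Interp.qsem, h]
    rfl
  | inter C D ih1 ih2 =>
    simp only [roleNameOccurs, not_or] at h
    simp only [Interp.qsem, ih1 h.1, ih2 h.2]
    rfl
  | union C D ih1 ih2 =>
    simp only [roleNameOccurs, not_or] at h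
    simp only [Interp.qsem, ih1 h.1, ih2 h.2]
    rfl
  | all r C ih | ex r C ih | atLeast n r C ih | atMost n r C ih =>
    simp only [roleNameOccurs, not_or] at h
    simp only [Interp.qsem, ih h.2.2, extI_role I R r h.1 h.2.1]
    rfl

theorem mem_restriction (I : Interp NC NR) (R : NR) (x : I.Δ)
    (hx : ∀ y, (x, y) ∈ I.interpR R) (r : CardRestriction NC NR) :
    x ∈ I.bsem (restrictionConcept R r) ↔ I.satCR r := by
  cases r <;>
    simp [restrictionConcept, Interp.bsem, Interp.satCR, Interp.reSem, Interp.roleSem, hx,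
      bsem_toB]

/-- For a CBox `C` over ALCQI-concepts and a role name `R` not occurring in `C`, the
ALCQIB-concept `C_C` is satisfiable iff the CBox `C` is satisfiable. -/
theorem cc_sat_iff_cbox_sat (R : NR) (L : List (CardRestriction NC NR))
    (hfresh : ∀ r ∈ L, ¬crUsesRole R r) :
    (∃ I : Interp NC NR, (I.bsem (CC R L)).Nonempty) ↔
    (∃ I : Interp NC NR, ∀ r ∈ L, I.satCR r) := by
  constructor
  · rintro ⟨I, x, hx⟩
    obtain ⟨h1, h2⟩ := hx
    have hR : ∀ y, (x, y) ∈ I.interpR R := by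
      simp only [Interp.bsem, Interp.reSem, Interp.roleSem, Set.mem_ofPred_eq, Nat.cast_zero,
        nonpos_iff_eq_zero, Set.encard_eq_zero, Set.mem_univ, and_true] at h1
      intro y
      by_contra hy
      exact (Set.eq_empty_iff_forall_notMem.mp h1 y) hy
    refine ⟨I, fun r hr => ?_⟩
    rw [mem_bigIB] at h2
    exact (mem_restriction I R x hR r).mp (h2 _ (List.mem_map_of_mem hr))
  · rintro ⟨I, hI⟩
    obtain ⟨x⟩ := (extI I R).nonempty
    have hR : ∀ x y : (extI I R).Δ, (x, y) ∈ (extI I R).interpR R := fun x y => Or.inl rfl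
    refine ⟨extI I R, x, ?_, ?_⟩
    · simp [Interp.bsem, Interp.reSem, Interp.roleSem, hR]
    · rw [mem_bigIB]
      intro C hC
      obtain ⟨r, hr, rfl⟩ := List.mem_map.mp hC
      refine (mem_restriction (extI I R) R x (hR x) r).mpr ?_
      have h1 := hI r hr
      have h2 := hfresh r hr
      cases r with
      | atLeast n C | atMost n C =>
        simp only [Interp.satCR] at h1 ⊢
        rw [extI_qsem I R C h2]
        exact h1

end Stmt11
end

section
/- Let C be an SI-concept in NNF. Then C is satisfiable if and only if there exists a tableau for C, i.e. a triple (S, L, E) with S a non-empty set, L : S → 2^{sub(C)}, and E : NR_C → 2^{S×S} (NR_C being the set of roles occurring in C together with their inverses) satisfying: (T1) C ∈ L(s) for some s ∈ S; and for all s, t ∈ S, all A, C₁, C₂, D ∈ sub(C) and all R ∈ NR_C: (T2) if A ∈ L(s) then ¬A ∉ L(s), for concept names A; (T3) if C₁ ⊓ C₂ ∈ L(s) then C₁ ∈ L(s) and C₂ ∈ L(s); (T4) if C₁ ⊔ C₂ ∈ L(s) then C₁ ∈ L(s) or C₂ ∈ L(s); (T5) if ∃R.D ∈ L(s) then there is t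 ∈ S with (s,t) ∈ E(R) and D ∈ L(t); (T6) if ∀R.D ∈ L(s) and (s,t) ∈ E(R) then D ∈ L(t); (T7) if ∀R.D ∈ L(s), (s,t) ∈ E(R) and Trans(R), then ∀R.D ∈ L(t); (T8) (s,t) ∈ E(R) iff (t,s) ∈ E(Inv(R)). -/
namespace Stmt12

/-- SI-roles: role names and their inverses -/
inductive Role (NR : Type) : Type
  | name : NR → Role NR
  | inv : NR → Role NR

/-- `Inv(R)` -/
def Role.invr {NR : Type} : Role NR → Role NR
  | .name R => .inv R
  | .inv R => .name R

/-- `Trans(R)`: `R ∈ NR₊` or `Inv(R) ∈ NR₊` (where `NR₊ ⊆ NR` is the set of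
transitive role names) -/
def TransR {NR : Type} (NRplus : Set NR) : Role NR → Prop
  | .name R => R ∈ NRplus
  | .inv R => R ∈ NRplus

/-- SI-concepts: ALC-concepts over possibly inverse roles -/
inductive Concept (NC NR : Type) : Type
  | atom : NC → Concept NC NR
  | neg : Concept NC NR → Concept NC NR
  | inter : Concept NC NR → Concept NC NR → Concept NC NR
  | union : Concept NC NR → Concept NC NR → Concept NC NR
  | all : Role NR → Concept NC NR → Concept NC NR
  | ex : Role NR → Concept NC NR → Concept NC NR

variable {NC NR : Type}

/-- negation normal form: negation occurs only in front of concept names -/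
def IsNNF : Concept NC NR → Prop
  | .atom _ => True
  | .neg (.atom _) => True
  | .neg _ => False
  | .inter C D => IsNNF C ∧ IsNNF D
  | .union C D => IsNNF C ∧ IsNNF D
  | .all _ C => IsNNF C
  | .ex _ C => IsNNF C

/-- subconcepts -/
def subs : Concept NC NR → Set (Concept NC NR)
  | .atom A => {.atom A}
  | .neg C => insert (.neg C) (subs C)
  | .inter C D => insert (.inter C D) (subs C ∪ subs D)
  | .union C D => insert (.union C D) (subs C ∪ subs D)
  | .all r C => insert (.all r C) (subs C)
  | .ex r C => insert (.ex r C) (subs C)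

structure Interp (NC NR : Type) where
  Δ : Type
  nonempty : Nonempty Δ
  interpC : NC → Set Δ
  interpR : NR → Set (Δ × Δ)

def Interp.roleSem (I : Interp NC NR) : Role NR → Set (I.Δ × I.Δ)
  | .name R => I.interpR R
  | .inv R => {p | (p.2, p.1) ∈ I.interpR R}

def Interp.sem (I : Interp NC NR) : Concept NC NR → Set I.Δ
  | .atom A => I.interpC A
  | .neg C => (I.sem C)ᶜ
  | .inter C D => I.sem C ∩ I.sem D
  | .union C D => I.sem C ∪ I.sem D
  | .all r C => {x | ∀ y, (x, y) ∈ I.roleSem r → y ∈ I.sem C}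
  | .ex r C => {x | ∃ y, (x, y) ∈ I.roleSem r ∧ y ∈ I.sem C}

theorem self_mem_subs (C : Concept NC NR) : C ∈ subs C := by
  cases C <;> simp [subs]

theorem subs_trans (C D : Concept NC NR) (h : D ∈ subs C) : subs D ⊆ subs C := by
  induction C with
  | atom A =>
    simp only [subs, Set.mem_singleton_iff] at h
    subst h; exact subset_rfl
  | neg C ih =>
    simp only [subs, Set.mem_insert_iff] at h
    rcases h with rfl | h
    · exact subset_rfl
    · exact (ih h).trans (Set.subset_insert _ _)
  | all r C ih =>
    simp only [subs, Set.mem_insert_iff] at h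
    rcases h with rfl | h
    · exact subset_rfl
    · exact (ih h).trans (Set.subset_insert _ _)
  | ex r C ih =>
    simp only [subs, Set.mem_insert_iff] at h
    rcases h with rfl | h
    · exact subset_rfl
    · exact (ih h).trans (Set.subset_insert _ _)
  | inter C1 C2 ih1 ih2 =>
    simp only [subs, Set.mem_insert_iff, Set.mem_union] at h
    rcases h with rfl | h | h
    · exact subset_rfl
    · exact (ih1 h).trans (Set.subset_union_left.trans (Set.subset_insert _ _))
    · exact (ih2 h).trans (Set.subset_union_right.trans (Set.subset_insert _ _))
  | union C1 C2 ih1 ih2 =>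
    simp only [subs, Set.mem_insert_iff, Set.mem_union] at h
    rcases h with rfl | h | h
    · exact subset_rfl
    · exact (ih1 h).trans (Set.subset_union_left.trans (Set.subset_insert _ _))
    · exact (ih2 h).trans (Set.subset_union_right.trans (Set.subset_insert _ _))

/-- An SI-concept `C` in NNF is satisfiable (in an interpretation interpreting all
transitive role names by transitive relations) iff there exists a tableau for `C`:
a triple `(S, L, E)` with `S` non-empty, `L : S → 2^{sub(C)}`, and `E` assigning to
each role a set of pairs, satisfying (T1)–(T8). -/
theorem si_tableau_iff_satisfiable (NRplus : Set NR) (C : Concept NC NR)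
    (hC : IsNNF C) :
    (∃ I : Interp NC NR,
      (∀ R ∈ NRplus, ∀ a b c : I.Δ,
        (a, b) ∈ I.interpR R → (b, c) ∈ I.interpR R → (a, c) ∈ I.interpR R) ∧
      (I.sem C).Nonempty) ↔
    (∃ (S : Type) (L : S → Set (Concept NC NR)) (E : Role NR → Set (S × S)),
      Nonempty S ∧
      (∀ s, L s ⊆ subs C) ∧
      -- (T1)
      (∃ s, C ∈ L s) ∧
      -- (T2)
      (∀ (s : S) (A : NC), Concept.atom A ∈ L s → Concept.neg (Concept.atom A) ∉ L s) ∧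
      -- (T3)
      (∀ (s : S) (C₁ C₂ : Concept NC NR),
        Concept.inter C₁ C₂ ∈ L s → C₁ ∈ L s ∧ C₂ ∈ L s) ∧
      -- (T4)
      (∀ (s : S) (C₁ C₂ : Concept NC NR),
        Concept.union C₁ C₂ ∈ L s → C₁ ∈ L s ∨ C₂ ∈ L s) ∧
      -- (T5)
      (∀ (s : S) (r : Role NR) (D : Concept NC NR),
        Concept.ex r D ∈ L s → ∃ t, (s, t) ∈ E r ∧ D ∈ L t) ∧
      -- (T6)
      (∀ (s t : S) (r : Role NR) (D : Concept NC NR),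
        Concept.all r D ∈ L s → (s, t) ∈ E r → D ∈ L t) ∧
      -- (T7)
      (∀ (s t : S) (r : Role NR) (D : Concept NC NR),
        Concept.all r D ∈ L s → (s, t) ∈ E r → TransR NRplus r →
          Concept.all r D ∈ L t) ∧
      -- (T8)
      (∀ (s t : S) (r : Role NR), (s, t) ∈ E r ↔ (t, s) ∈ E r.invr)) := by
  constructor
  · rintro ⟨I, hT, x, hx⟩
    refine ⟨I.Δ, fun s => {D | D ∈ subs C ∧ s ∈ I.sem D}, I.roleSem, I.nonempty,
      fun s D h => h.1, ⟨x, self_mem_subs C, hx⟩, ?_, ?_, ?_, ?_, ?_, ?_, ?_⟩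
    · intro s A h1 h2
      exact h2.2 h1.2
    · rintro s C₁ C₂ ⟨h1, h2⟩
      exact ⟨⟨subs_trans _ _ h1 (by simp [subs, self_mem_subs]), h2.1⟩,
        ⟨subs_trans _ _ h1 (by simp [subs, self_mem_subs]), h2.2⟩⟩
    · rintro s C₁ C₂ ⟨h1, h2⟩
      rcases h2 with h2 | h2
      · exact Or.inl ⟨subs_trans _ _ h1 (by simp [subs, self_mem_subs]), h2⟩
      · exact Or.inr ⟨subs_trans _ _ h1 (by simp [subs, self_mem_subs]), h2⟩
    · rintro s r D ⟨h1, t, h2, h3⟩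
      exact ⟨t, h2, subs_trans _ _ h1 (by simp [subs, self_mem_subs]), h3⟩
    · rintro s t r D ⟨h1, h2⟩ h
      exact ⟨subs_trans _ _ h1 (by simp [subs, self_mem_subs]), h2 t h⟩
    · rintro s t r D ⟨h1, h2⟩ h hr
      refine ⟨h1, fun y hy => h2 y ?_⟩
      cases r with
      | name R => exact hT R hr _ _ _ h hy
      | inv R => exact hT R hr _ _ _ hy h
    · intro s t r
      cases r <;> exact Iff.rfl
  · rintro ⟨S, L, E, hS, hsub, ⟨s0, hs0⟩, T2, T3, T4, T5, T6, T7, T8⟩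
    let I : Interp NC NR :=
      { Δ := S
        nonempty := hS
        interpC := fun A => {s | Concept.atom A ∈ L s}
        interpR := fun R => {p | (p.1, p.2) ∈ E (.name R) ∨
          (R ∈ NRplus ∧ Relation.TransGen (fun a b => (a, b) ∈ E (.name R)) p.1 p.2)} }
    have key : ∀ (r : Role NR) (D : Concept NC NR) (s t : S), TransR NRplus r →
        Relation.TransGen (fun a b => (a, b) ∈ E r) s t → Concept.all r D ∈ L s →
        D ∈ L t ∧ Concept.all r D ∈ L t := by
      intro r D s t hr h hs
      induction h with
      | single h => exact ⟨T6 _ _ _ _ hs h, T7 _ _ _ _ hs h hr⟩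
      | tail _ h ih => exact ⟨T6 _ _ _ _ ih.2 h, T7 _ _ _ _ ih.2 h hr⟩
    have hE : ∀ (r : Role NR) (s t : S), (s, t) ∈ E r → (s, t) ∈ I.roleSem r := by
      intro r s t h
      cases r with
      | name R => exact Or.inl h
      | inv R => exact Or.inl ((T8 s t (.inv R)).1 h)
    have hall : ∀ (r : Role NR) (D : Concept NC NR) (s t : S), (s, t) ∈ I.roleSem r →
        Concept.all r D ∈ L s → D ∈ L t := by
      intro r D s t h hs
      cases r with
      | name R =>
        rcases h with h | ⟨hR, h⟩
        · exact T6 _ _ _ _ hs h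
        · exact (key (.name R) D s t hR h hs).1
      | inv R =>
        rcases h with h | ⟨hR, h⟩
        · exact T6 _ _ _ _ hs ((T8 t s (.name R)).1 h)
        · refine (key (.inv R) D s t hR ?_ hs).1
          have h' := Relation.transGen_swap.2 h
          exact Relation.TransGen.mono (fun a b hab => (T8 b a (.name R)).1 hab) _ _ h'
    have main : ∀ (D : Concept NC NR), IsNNF D → ∀ s : S, D ∈ L s → s ∈ I.sem D := by
      intro D
      induction D with
      | atom A => intro _ s h; exact h
      | neg D ih =>
        intro hD s h
        cases D with
        | atom A => exact fun h' => T2 s A h' h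
        | _ => exact hD.elim
      | inter D1 D2 ih1 ih2 =>
        intro hD s h
        exact ⟨ih1 hD.1 s (T3 _ _ _ h).1, ih2 hD.2 s (T3 _ _ _ h).2⟩
      | union D1 D2 ih1 ih2 =>
        intro hD s h
        exact (T4 _ _ _ h).imp (ih1 hD.1 s) (ih2 hD.2 s)
      | all r D ih =>
        intro hD s h t ht
        exact ih hD t (hall r D s t ht h)
      | ex r D ih =>
        intro hD s h
        obtain ⟨t, h1, h2⟩ := T5 _ _ _ h
        exact ⟨t, hE r s t h1, ih hD t h2⟩
    refine ⟨I, ?_, s0, main C hC s0 hs0⟩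
    intro R hR a b c hab hbc
    have hg : ∀ a b : S, (a, b) ∈ I.interpR R →
        Relation.TransGen (fun a b => (a, b) ∈ E (.name R)) a b := by
      rintro a b (h | h)
      · exact .single h
      · exact h.2
    exact Or.inr ⟨hR, (hg a b hab).trans (hg b c hbc)⟩


end Stmt12
end

section
/- Let C be a SHIQ-concept, R a role hierarchy and T a SHIQ-TBox. Define C_T = ⨅_{Cᵢ ⊑ Dᵢ ∈ T} (¬Cᵢ ⊔ Dᵢ), let U ∈ NR₊ be a transitive role name not occurring in T, C, or R, and set R_U = R ∪ {R ⊑ U, Inv(R) ⊑ U | R occurs in T, C, or R}. Then C is satisfiable w.r.t. T and R if and only if C ⊓ C_T ⊓ ∀U.C_T is satisfiable w.r.t. R_U. -/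
namespace Stmt15

/-- roles: role names and their inverses -/
inductive Role (NR : Type) : Type
  | name : NR → Role NR
  | inv : NR → Role NR

/-- `Inv(R)` -/
def Role.invr {NR : Type} : Role NR → Role NR
  | .name R => .inv R
  | .inv R => .name R

/-- `Trans(R)`: `R ∈ NR₊` or `Inv(R) ∈ NR₊` -/
def TransR {NR : Type} (NRplus : Set NR) : Role NR → Prop
  | .name R => R ∈ NRplus
  | .inv R => R ∈ NRplus

/-- SHIQ-concepts (with ⊤ for the empty conjunction) -/
inductive Concept (NC NR : Type) : Type
  | top : Concept NC NR
  | atom : NC → Concept NC NR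
  | neg : Concept NC NR → Concept NC NR
  | inter : Concept NC NR → Concept NC NR → Concept NC NR
  | union : Concept NC NR → Concept NC NR → Concept NC NR
  | all : Role NR → Concept NC NR → Concept NC NR
  | ex : Role NR → Concept NC NR → Concept NC NR
  | atLeast : ℕ → Role NR → Concept NC NR → Concept NC NR
  | atMost : ℕ → Role NR → Concept NC NR → Concept NC NR

variable {NC NR : Type}

/-- `⊑*`: the transitive-reflexive closure of `R ∪ {Inv(R) ⊑ Inv(S) | R ⊑ S ∈ R}` -/
def subRole (H : Set (Role NR × Role NR)) : Role NR → Role NR → Prop :=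
  Relation.ReflTransGen fun a b => (a, b) ∈ H ∨ (a.invr, b.invr) ∈ H

/-- a role is simple iff it has no transitive sub-role -/
def Simple (H : Set (Role NR × Role NR)) (NRplus : Set NR) (s : Role NR) : Prop :=
  ¬∃ t : Role NR, TransR NRplus t ∧ subRole H t s

/-- well-formedness of SHIQ-concepts: number restrictions only on simple roles -/
def WF (H : Set (Role NR × Role NR)) (NRplus : Set NR) : Concept NC NR → Prop
  | .top => True
  | .atom _ => True
  | .neg C => WF H NRplus C
  | .inter C D => WF H NRplus C ∧ WF H NRplus D
  | .union C D => WF H NRplus C ∧ WF H NRplus D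
  | .all _ C => WF H NRplus C
  | .ex _ C => WF H NRplus C
  | .atLeast _ s C => Simple H NRplus s ∧ WF H NRplus C
  | .atMost _ s C => Simple H NRplus s ∧ WF H NRplus C

structure Interp (NC NR : Type) where
  Δ : Type
  nonempty : Nonempty Δ
  interpC : NC → Set Δ
  interpR : NR → Set (Δ × Δ)

def Interp.roleSem (I : Interp NC NR) : Role NR → Set (I.Δ × I.Δ)
  | .name R => I.interpR R
  | .inv R => {p | (p.2, p.1) ∈ I.interpR R}

def Interp.sem (I : Interp NC NR) : Concept NC NR → Set I.Δ
  | .top => Set.univ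
  | .atom A => I.interpC A
  | .neg C => (I.sem C)ᶜ
  | .inter C D => I.sem C ∩ I.sem D
  | .union C D => I.sem C ∪ I.sem D
  | .all r C => {x | ∀ y, (x, y) ∈ I.roleSem r → y ∈ I.sem C}
  | .ex r C => {x | ∃ y, (x, y) ∈ I.roleSem r ∧ y ∈ I.sem C}
  | .atLeast n r C => {x | (n : ℕ∞) ≤ {y | (x, y) ∈ I.roleSem r ∧ y ∈ I.sem C}.encard}
  | .atMost n r C => {x | {y | (x, y) ∈ I.roleSem r ∧ y ∈ I.sem C}.encard ≤ (n : ℕ∞)}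

/-- the roles occurring in a concept -/
def rolesOf : Concept NC NR → Set (Role NR)
  | .top => ∅
  | .atom _ => ∅
  | .neg C => rolesOf C
  | .inter C D => rolesOf C ∪ rolesOf D
  | .union C D => rolesOf C ∪ rolesOf D
  | .all r C => insert r (rolesOf C)
  | .ex r C => insert r (rolesOf C)
  | .atLeast _ r C => insert r (rolesOf C)
  | .atMost _ r C => insert r (rolesOf C)

/-- conjunction of a list of concepts -/
def bigI : List (Concept NC NR) → Concept NC NR
  | [] => .top
  | [C] => C
  | C :: D :: l => .inter C (bigI (D :: l))

/-- `C_T = ⨅_{Cᵢ ⊑ Dᵢ ∈ T} (¬Cᵢ ⊔ Dᵢ)` -/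
def CT (T : List (Concept NC NR × Concept NC NR)) : Concept NC NR :=
  bigI (T.map fun p => .union (.neg p.1) p.2)

/-- the role `r` occurs in `C`, in `T`, or in `R` -/
def OccursRole (C : Concept NC NR) (T : List (Concept NC NR × Concept NC NR))
    (H : Set (Role NR × Role NR)) (r : Role NR) : Prop :=
  r ∈ rolesOf C ∨ (∃ p ∈ T, r ∈ rolesOf p.1 ∨ r ∈ rolesOf p.2) ∨
    (∃ p ∈ H, r = p.1 ∨ r = p.2)

/-- the role `r` is built from the role name `U` -/
def UsesName (U : NR) (r : Role NR) : Prop := r = .name U ∨ r = .inv U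

/-- `R_U = R ∪ {R ⊑ U, Inv(R) ⊑ U | R occurs in T, C, or R}` -/
def RU (C : Concept NC NR) (T : List (Concept NC NR × Concept NC NR))
    (H : Set (Role NR × Role NR)) (U : NR) : Set (Role NR × Role NR) :=
  H ∪ {q | ∃ r : Role NR, OccursRole C T H r ∧
    (q = (r, Role.name U) ∨ q = (r.invr, Role.name U))}

/-- satisfiability w.r.t. a role hierarchy -/
def Sat (NRplus : Set NR) (H : Set (Role NR × Role NR)) (C : Concept NC NR) : Prop :=
  ∃ I : Interp NC NR,
    (∀ R ∈ NRplus, ∀ a b c : I.Δ,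
      (a, b) ∈ I.interpR R → (b, c) ∈ I.interpR R → (a, c) ∈ I.interpR R) ∧
    (∀ p ∈ H, I.roleSem p.1 ⊆ I.roleSem p.2) ∧
    (I.sem C).Nonempty

theorem sem_transfer (I J : Interp NC NR) (f : J.Δ → I.Δ) (hf : Function.Injective f)
    (hA : ∀ A a, a ∈ J.interpC A ↔ f a ∈ I.interpC A) (D : Concept NC NR)
    (hr : ∀ r ∈ rolesOf D, (∀ a b, (a, b) ∈ J.roleSem r ↔ (f a, f b) ∈ I.roleSem r) ∧
      ∀ a b', (f a, b') ∈ I.roleSem r → ∃ b, f b = b') :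
    ∀ a, a ∈ J.sem D ↔ f a ∈ I.sem D := by
  have key : ∀ (r : Role NR) (E : Concept NC NR),
      ((∀ a b, (a, b) ∈ J.roleSem r ↔ (f a, f b) ∈ I.roleSem r) ∧
        ∀ a b', (f a, b') ∈ I.roleSem r → ∃ b, f b = b') →
      (∀ a, a ∈ J.sem E ↔ f a ∈ I.sem E) → ∀ a,
      {y | (f a, y) ∈ I.roleSem r ∧ y ∈ I.sem E} =
        f '' {y | (a, y) ∈ J.roleSem r ∧ y ∈ J.sem E} := by
    intro r E h hE a
    ext y
    simp only [Set.mem_ofPred_eq, Set.mem_image]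
    constructor
    · rintro ⟨h1, h2⟩
      obtain ⟨b, rfl⟩ := h.2 a y h1
      exact ⟨b, ⟨(h.1 a b).2 h1, (hE b).2 h2⟩, rfl⟩
    · rintro ⟨b, ⟨h1, h2⟩, rfl⟩
      exact ⟨(h.1 a b).1 h1, (hE b).1 h2⟩
  induction D with
  | top => intro a; simp [Interp.sem]
  | atom A => intro a; exact hA A a
  | neg E ih =>
    intro a
    have := ih hr a
    simp only [Interp.sem, Set.mem_compl_iff, this]
  | inter E F ih1 ih2 =>
    intro a
    have h1 := ih1 (fun r h => hr r (Or.inl h)) a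
    have h2 := ih2 (fun r h => hr r (Or.inr h)) a
    simp only [Interp.sem, Set.mem_inter_iff, h1, h2]
  | union E F ih1 ih2 =>
    intro a
    have h1 := ih1 (fun r h => hr r (Or.inl h)) a
    have h2 := ih2 (fun r h => hr r (Or.inr h)) a
    simp only [Interp.sem, Set.mem_union, h1, h2]
  | all r E ih =>
    intro a
    have hE := ih (fun r h => hr r (Or.inr h))
    have h := hr r (Or.inl rfl)
    simp only [Interp.sem, Set.mem_ofPred_eq]
    constructor
    · intro H y hy
      obtain ⟨b, rfl⟩ := h.2 a y hy
      exact (hE b).1 (H b ((h.1 a b).2 hy))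
    · intro H b hb
      exact (hE b).2 (H _ ((h.1 a b).1 hb))
  | ex r E ih =>
    intro a
    have hE := ih (fun r h => hr r (Or.inr h))
    have h := hr r (Or.inl rfl)
    simp only [Interp.sem, Set.mem_ofPred_eq]
    constructor
    · rintro ⟨b, h1, h2⟩
      exact ⟨f b, (h.1 a b).1 h1, (hE b).1 h2⟩
    · rintro ⟨y, h1, h2⟩
      obtain ⟨b, rfl⟩ := h.2 a y h1
      exact ⟨b, (h.1 a b).2 h1, (hE b).2 h2⟩
  | atLeast n r E ih =>
    intro a
    have hE := ih (fun r h => hr r (Or.inr h))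
    have h := hr r (Or.inl rfl)
    simp only [Interp.sem, Set.mem_ofPred_eq]
    rw [key r E h hE a, hf.encard_image]
  | atMost n r E ih =>
    intro a
    have hE := ih (fun r h => hr r (Or.inr h))
    have h := hr r (Or.inl rfl)
    simp only [Interp.sem, Set.mem_ofPred_eq]
    rw [key r E h hE a, hf.encard_image]

theorem mem_bigI (I : Interp NC NR) (l : List (Concept NC NR)) (x : I.Δ) :
    x ∈ I.sem (bigI l) ↔ ∀ D ∈ l, x ∈ I.sem D := by
  induction l with
  | nil => simp [bigI, Interp.sem]
  | cons D l ih =>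
    cases l with
    | nil => simp [bigI]
    | cons E l =>
      rw [List.forall_mem_cons, ← ih]
      simp only [bigI, Interp.sem, Set.mem_inter_iff]

theorem mem_CT (I : Interp NC NR) (T : List (Concept NC NR × Concept NC NR)) (x : I.Δ) :
    x ∈ I.sem (CT T) ↔ ∀ p ∈ T, x ∈ I.sem p.1 → x ∈ I.sem p.2 := by
  rw [CT, mem_bigI, List.forall_mem_map]
  refine forall₂_congr fun p _ => ?_
  simp only [Interp.sem, Set.mem_union, Set.mem_compl_iff]
  tauto

/-- Internalization of TBoxes: `C` is satisfiable w.r.t. the TBox `T` and the role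
hierarchy `R` iff `C ⊓ C_T ⊓ ∀U.C_T` is satisfiable w.r.t. `R_U`, where `U ∈ NR₊` is a
transitive role name not occurring in `T`, `C`, or `R`. -/
theorem internalisation (NRplus : Set NR) (H : Set (Role NR × Role NR))
    (hfin : H.Finite)
    (T : List (Concept NC NR × Concept NC NR)) (C : Concept NC NR)
    (hWFC : WF H NRplus C)
    (hWFT : ∀ p ∈ T, WF H NRplus p.1 ∧ WF H NRplus p.2)
    (U : NR) (hU : U ∈ NRplus)
    (hfresh : ∀ r : Role NR, OccursRole C T H r → ¬UsesName U r) :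
    (∃ I : Interp NC NR,
      (∀ R ∈ NRplus, ∀ a b c : I.Δ,
        (a, b) ∈ I.interpR R → (b, c) ∈ I.interpR R → (a, c) ∈ I.interpR R) ∧
      (∀ p ∈ H, I.roleSem p.1 ⊆ I.roleSem p.2) ∧
      (∀ p ∈ T, I.sem p.1 ⊆ I.sem p.2) ∧
      (I.sem C).Nonempty) ↔
    Sat NRplus (RU C T H U)
      (.inter (.inter C (CT T)) (.all (.name U) (CT T))) := by
  classical
  constructor
  · rintro ⟨I, htr, hH, hT, x, hx⟩
    let J : Interp NC NR :=
      ⟨I.Δ, I.nonempty, I.interpC, fun R => if R = U then Set.univ else I.interpR R⟩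
    have hJ : ∀ r, OccursRole C T H r → J.roleSem r = I.roleSem r := by
      intro r hr
      have := hfresh r hr
      cases r with
      | name R =>
        have hne : R ≠ U := fun h => this (Or.inl (by rw [h]))
        simp [Interp.roleSem, J, hne]
      | inv R =>
        have hne : R ≠ U := fun h => this (Or.inr (by rw [h]))
        simp [Interp.roleSem, J, hne]
    have hs : ∀ D : Concept NC NR, (∀ r ∈ rolesOf D, OccursRole C T H r) →
        ∀ a : I.Δ, a ∈ J.sem D ↔ a ∈ I.sem D := by
      intro D hD
      refine sem_transfer I J id Function.injective_id (fun _ _ => Iff.rfl) D ?_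
      intro r hr
      refine ⟨fun a b => ?_, fun a b' _ => ⟨b', rfl⟩⟩
      rw [hJ r (hD r hr)]; rfl
    have hall : ∀ y : J.Δ, y ∈ J.sem (CT T) := by
      intro y
      rw [mem_CT]
      intro p hp h
      exact (hs p.2 (fun r hr => Or.inr (Or.inl ⟨p, hp, Or.inr hr⟩)) y).2
        (hT p hp ((hs p.1 (fun r hr => Or.inr (Or.inl ⟨p, hp, Or.inl hr⟩)) y).1 h))
    refine ⟨J, ?_, ?_, x, ⟨(hs C (fun r hr => Or.inl hr) x).2 hx, hall x⟩, fun y _ => hall y⟩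
    · intro R hR a b c h1 h2
      by_cases hRU : R = U
      · simp [J, hRU]
      · simp only [J, hRU, if_false] at h1 h2 ⊢
        exact htr R hR a b c h1 h2
    · rintro p (hp | ⟨r, -, rfl | rfl⟩)
      · rw [hJ p.1 (Or.inr (Or.inr ⟨p, hp, Or.inl rfl⟩)),
          hJ p.2 (Or.inr (Or.inr ⟨p, hp, Or.inr rfl⟩))]
        exact hH p hp
      · intro q _; simp [Interp.roleSem, J]
      · intro q _; simp [Interp.roleSem, J]
  · rintro ⟨I, htr, hH, x, ⟨hxC, hxT⟩, hxU⟩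
    let J : Interp NC NR :=
      ⟨{y : I.Δ // y = x ∨ (x, y) ∈ I.interpR U}, ⟨⟨x, Or.inl rfl⟩⟩,
        fun A => {a | a.1 ∈ I.interpC A}, fun R => {p | (p.1.1, p.2.1) ∈ I.interpR R}⟩
    have hJ : ∀ (r : Role NR) (a b : J.Δ),
        (a, b) ∈ J.roleSem r ↔ (a.1, b.1) ∈ I.roleSem r := by
      intro r a b
      cases r <;> exact Iff.rfl
    have hs : ∀ D : Concept NC NR, (∀ r ∈ rolesOf D, OccursRole C T H r) →
        ∀ a : J.Δ, a ∈ J.sem D ↔ a.1 ∈ I.sem D := by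
      intro D hD
      refine sem_transfer I J Subtype.val Subtype.val_injective (fun _ _ => Iff.rfl) D ?_
      intro r hr
      refine ⟨hJ r, ?_⟩
      rintro ⟨a, ha⟩ b hab
      have hU' : (a, b) ∈ I.interpR U :=
        hH (r, .name U) (Or.inr ⟨r, hD r hr, Or.inl rfl⟩) hab
      refine ⟨⟨b, Or.inr ?_⟩, rfl⟩
      rcases ha with rfl | ha
      · exact hU'
      · exact htr U hU _ _ _ ha hU'
    refine ⟨J, ?_, ?_, ?_, ⟨x, Or.inl rfl⟩, (hs C (fun r hr => Or.inl hr) _).2 hxC⟩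
    · intro R hR a b c h1 h2
      exact htr R hR a.1 b.1 c.1 h1 h2
    · rintro p hp ⟨a, b⟩ hab
      exact (hJ _ a b).2 (hH p (Or.inl hp) ((hJ _ a b).1 hab))
    · intro p hp a ha
      have haT : a.1 ∈ I.sem (CT T) := by
        rcases a.2 with h | h
        · rw [h]; exact hxT
        · exact hxU _ h
      exact (hs p.2 (fun r hr => Or.inr (Or.inl ⟨p, hp, Or.inr hr⟩)) a).2
        ((mem_CT I T a.1).1 haT p hp
          ((hs p.1 (fun r hr => Or.inr (Or.inl ⟨p, hp, Or.inl hr⟩)) a).1 ha))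

end Stmt15
end

section
/- Let C be a SHIQ-concept in NNF and R a cycle-free role hierarchy. For every concept ∀R.D ∈ clos(C,R) let X_{R,D} be a fresh concept name, and define the translation ·^tr by: A^tr = A and (¬A)^tr = ¬A for concept names A; (C₁ ⊓ C₂)^tr = C₁^tr ⊓ C₂^tr; (C₁ ⊔ C₂)^tr = C₁^tr ⊔ C₂^tr; (⋈ n R D)^tr = (⋈ n R↑ D^tr) for ⋈ ∈ {≥, ≤}; (∀R.D)^tr = X_{R,D}; and (∃R.D)^tr = ¬X_{R,~D}. Define the TBox T_C = {X_{R,D} ≐ ∀R↑.D^tr | ∀R.D ∈ clos(C,R)} ∪ {X_{R,D} ⊑ ⨅_{T ⊑* R, Trans(T)} ∀T↑.X_{T,D} | ∀R.D ∈ clos(C,R)}. Then C is satisfiable w.r.t. R (with transitive role names interpreted transitively) if and only if the concept C^tr is satisfiable w.r.t. the TBox T_C, where in the latter problem all roles are interpreted by arbitrary binary relations with no transitivity or hierarchy requirements. -/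
namespace Stmt16

/-- roles: role names and their inverses -/
inductive Role (NR : Type) : Type
  | name : NR → Role NR
  | inv : NR → Role NR

/-- `Inv(R)` -/
def Role.invr {NR : Type} : Role NR → Role NR
  | .name R => .inv R
  | .inv R => .name R

/-- `Trans(R)`: `R ∈ NR₊` or `Inv(R) ∈ NR₊` -/
def TransR {NR : Type} (NRplus : Set NR) : Role NR → Prop
  | .name R => R ∈ NRplus
  | .inv R => R ∈ NRplus

/-- SHIQ-concepts (with ⊤ and ⊥) -/
inductive Concept (NC NR : Type) : Type
  | top : Concept NC NR
  | bot : Concept NC NR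
  | atom : NC → Concept NC NR
  | neg : Concept NC NR → Concept NC NR
  | inter : Concept NC NR → Concept NC NR → Concept NC NR
  | union : Concept NC NR → Concept NC NR → Concept NC NR
  | all : Role NR → Concept NC NR → Concept NC NR
  | ex : Role NR → Concept NC NR → Concept NC NR
  | atLeast : ℕ → Role NR → Concept NC NR → Concept NC NR
  | atMost : ℕ → Role NR → Concept NC NR → Concept NC NR

variable {NC NR : Type}

/-- negation normal form: negation occurs only in front of concept names -/
def IsNNF : Concept NC NR → Prop
  | .top => True
  | .bot => True
  | .atom _ => True
  | .neg (.atom _) => True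
  | .neg _ => False
  | .inter C D => IsNNF C ∧ IsNNF D
  | .union C D => IsNNF C ∧ IsNNF D
  | .all _ C => IsNNF C
  | .ex _ C => IsNNF C
  | .atLeast _ _ C => IsNNF C
  | .atMost _ _ C => IsNNF C

/-- `~C`, the NNF of `¬C` -/
def nnfNeg : Concept NC NR → Concept NC NR
  | .top => .bot
  | .bot => .top
  | .atom A => .neg (.atom A)
  | .neg C => C
  | .inter C D => .union (nnfNeg C) (nnfNeg D)
  | .union C D => .inter (nnfNeg C) (nnfNeg D)
  | .all r C => .ex r (nnfNeg C)
  | .ex r C => .all r (nnfNeg C)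
  | .atLeast 0 _ _ => .bot
  | .atLeast (n + 1) r C => .atMost n r C
  | .atMost n r C => .atLeast (n + 1) r C

/-- subconcepts -/
def subs : Concept NC NR → Set (Concept NC NR)
  | .top => {.top}
  | .bot => {.bot}
  | .atom A => {.atom A}
  | .neg C => insert (.neg C) (subs C)
  | .inter C D => insert (.inter C D) (subs C ∪ subs D)
  | .union C D => insert (.union C D) (subs C ∪ subs D)
  | .all r C => insert (.all r C) (subs C)
  | .ex r C => insert (.ex r C) (subs C)
  | .atLeast n r C => insert (.atLeast n r C) (subs C)
  | .atMost n r C => insert (.atMost n r C) (subs C)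

/-- `⊑*`: the transitive-reflexive closure of `R ∪ {Inv(R) ⊑ Inv(S) | R ⊑ S ∈ R}` -/
def subRole (H : Set (Role NR × Role NR)) : Role NR → Role NR → Prop :=
  Relation.ReflTransGen fun a b => (a, b) ∈ H ∨ (a.invr, b.invr) ∈ H

/-- a role is simple iff it has no transitive sub-role -/
def Simple (H : Set (Role NR × Role NR)) (NRplus : Set NR) (s : Role NR) : Prop :=
  ¬∃ t : Role NR, TransR NRplus t ∧ subRole H t s

/-- well-formedness of SHIQ-concepts: number restrictions only on simple roles -/
def WF (H : Set (Role NR × Role NR)) (NRplus : Set NR) : Concept NC NR → Prop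
  | .top => True
  | .bot => True
  | .atom _ => True
  | .neg C => WF H NRplus C
  | .inter C D => WF H NRplus C ∧ WF H NRplus D
  | .union C D => WF H NRplus C ∧ WF H NRplus D
  | .all _ C => WF H NRplus C
  | .ex _ C => WF H NRplus C
  | .atLeast _ s C => Simple H NRplus s ∧ WF H NRplus C
  | .atMost _ s C => Simple H NRplus s ∧ WF H NRplus C

/-- membership in `clos(C,R)`: the smallest set of concepts containing `C`, closed
under subconcepts and `~`, and containing `∀T.D` whenever it contains `∀R.D` with
`T ⊑* R` and `Trans(T)` -/
inductive InClos (H : Set (Role NR × Role NR)) (NRplus : Set NR) (C : Concept NC NR) :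
    Concept NC NR → Prop
  | base : InClos H NRplus C C
  | subc {D E : Concept NC NR} : InClos H NRplus C D → E ∈ subs D → InClos H NRplus C E
  | nnf {D : Concept NC NR} : InClos H NRplus C D → InClos H NRplus C (nnfNeg D)
  | trans {r t : Role NR} {D : Concept NC NR} : InClos H NRplus C (.all r D) →
      subRole H t r → TransR NRplus t → InClos H NRplus C (.all t D)

structure Interp (NC NR : Type) where
  Δ : Type
  nonempty : Nonempty Δ
  interpC : NC → Set Δ
  interpR : NR → Set (Δ × Δ)

def Interp.roleSem (I : Interp NC NR) : Role NR → Set (I.Δ × I.Δ)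
  | .name R => I.interpR R
  | .inv R => {p | (p.2, p.1) ∈ I.interpR R}

/-- semantics of SHIQ-concepts -/
def Interp.sem (I : Interp NC NR) : Concept NC NR → Set I.Δ
  | .top => Set.univ
  | .bot => ∅
  | .atom A => I.interpC A
  | .neg C => (I.sem C)ᶜ
  | .inter C D => I.sem C ∩ I.sem D
  | .union C D => I.sem C ∪ I.sem D
  | .all r C => {x | ∀ y, (x, y) ∈ I.roleSem r → y ∈ I.sem C}
  | .ex r C => {x | ∃ y, (x, y) ∈ I.roleSem r ∧ y ∈ I.sem C}
  | .atLeast n r C => {x | (n : ℕ∞) ≤ {y | (x, y) ∈ I.roleSem r ∧ y ∈ I.sem C}.encard}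
  | .atMost n r C => {x | {y | (x, y) ∈ I.roleSem r ∧ y ∈ I.sem C}.encard ≤ (n : ℕ∞)}

/-- satisfiability of a SHIQ-concept w.r.t. a role hierarchy (transitive role names
interpreted transitively) -/
def Sat (NRplus : Set NR) (H : Set (Role NR × Role NR)) (C : Concept NC NR) : Prop :=
  ∃ I : Interp NC NR,
    (∀ R ∈ NRplus, ∀ a b c : I.Δ,
      (a, b) ∈ I.interpR R → (b, c) ∈ I.interpR R → (a, c) ∈ I.interpR R) ∧
    (∀ p ∈ H, I.roleSem p.1 ⊆ I.roleSem p.2) ∧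
    (I.sem C).Nonempty

/-- `R↑`: the set of super-roles of `R` (the role conjunction `⨅_{R ⊑* S} S`) -/
def up (H : Set (Role NR × Role NR)) (r : Role NR) : Set (Role NR) :=
  {s | subRole H r s}

/-- target concepts: ALCQIb-like concepts whose value and number restrictions use
role conjunctions (given as the set of conjoined roles) -/
inductive BConcept (NC' NR : Type) : Type
  | top : BConcept NC' NR
  | bot : BConcept NC' NR
  | atom : NC' → BConcept NC' NR
  | neg : BConcept NC' NR → BConcept NC' NR
  | inter : BConcept NC' NR → BConcept NC' NR → BConcept NC' NR
  | union : BConcept NC' NR → BConcept NC' NR → BConcept NC' NR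
  | allS : Set (Role NR) → BConcept NC' NR → BConcept NC' NR
  | atLeastS : ℕ → Set (Role NR) → BConcept NC' NR → BConcept NC' NR
  | atMostS : ℕ → Set (Role NR) → BConcept NC' NR → BConcept NC' NR

/-- semantics of target concepts; a role conjunction relates `x` to `y` iff every
conjoined role does -/
def Interp.bsem {NC' : Type} (I : Interp NC' NR) : BConcept NC' NR → Set I.Δ
  | .top => Set.univ
  | .bot => ∅
  | .atom A => I.interpC A
  | .neg C => (I.bsem C)ᶜ
  | .inter C D => I.bsem C ∩ I.bsem D
  | .union C D => I.bsem C ∪ I.bsem D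
  | .allS s C => {x | ∀ y, (∀ r ∈ s, (x, y) ∈ I.roleSem r) → y ∈ I.bsem C}
  | .atLeastS n s C =>
      {x | (n : ℕ∞) ≤ {y | (∀ r ∈ s, (x, y) ∈ I.roleSem r) ∧ y ∈ I.bsem C}.encard}
  | .atMostS n s C =>
      {x | {y | (∀ r ∈ s, (x, y) ∈ I.roleSem r) ∧ y ∈ I.bsem C}.encard ≤ (n : ℕ∞)}

/-- TBox axioms over target concepts -/
inductive BAxiom (NC' NR : Type) : Type
  | sub : BConcept NC' NR → BConcept NC' NR → BAxiom NC' NR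
  | eq : BConcept NC' NR → BConcept NC' NR → BAxiom NC' NR

def Interp.satBAx {NC' : Type} (I : Interp NC' NR) : BAxiom NC' NR → Prop
  | .sub C D => I.bsem C ⊆ I.bsem D
  | .eq C D => I.bsem C = I.bsem D

/-- the fresh concept names: `X_{R,D} = Sum.inr (R, D)`; the original concept names
are embedded via `Sum.inl` -/
abbrev NCX (NC NR : Type) : Type := NC ⊕ (Role NR × Concept NC NR)

/-- the translation `·^tr`: `A^tr = A`, `(¬A)^tr = ¬A`, homomorphic on ⊓ and ⊔,
`(⋈ n R D)^tr = (⋈ n R↑ D^tr)`, `(∀R.D)^tr = X_{R,D}`, `(∃R.D)^tr = ¬X_{R,~D}` -/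
def tr (H : Set (Role NR × Role NR)) : Concept NC NR → BConcept (NCX NC NR) NR
  | .top => .top
  | .bot => .bot
  | .atom A => .atom (Sum.inl A)
  | .neg C => .neg (tr H C)
  | .inter C D => .inter (tr H C) (tr H D)
  | .union C D => .union (tr H C) (tr H D)
  | .all r D => .atom (Sum.inr (r, D))
  | .ex r D => .neg (.atom (Sum.inr (r, nnfNeg D)))
  | .atLeast n r D => .atLeastS n (up H r) (tr H D)
  | .atMost n r D => .atMostS n (up H r) (tr H D)

/-- the TBox `T_C`, consisting, for each `∀R.D ∈ clos(C,R)`, of the axiom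
`X_{R,D} ≐ ∀R↑.D^tr` and (splitting the conjunction on the right-hand side into
separate axioms) of the axioms `X_{R,D} ⊑ ∀T↑.X_{T,D}` for each `T ⊑* R` with
`Trans(T)` -/
def TC (H : Set (Role NR × Role NR)) (NRplus : Set NR) (C : Concept NC NR) :
    Set (BAxiom (NCX NC NR) NR) :=
  {ax | ∃ (r : Role NR) (D : Concept NC NR), InClos H NRplus C (.all r D) ∧
    ax = .eq (.atom (Sum.inr (r, D))) (.allS (up H r) (tr H D))} ∪
  {ax | ∃ (r t : Role NR) (D : Concept NC NR), InClos H NRplus C (.all r D) ∧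
    subRole H t r ∧ TransR NRplus t ∧
    ax = .sub (.atom (Sum.inr (r, D))) (.allS (up H t) (.atom (Sum.inr (t, D))))}

theorem invr_invr (r : Role NR) : r.invr.invr = r := by cases r <;> rfl

theorem roleSem_invr {N : Type} (I : Interp N NR) (r : Role NR) (x y : I.Δ) :
    (x, y) ∈ I.roleSem r.invr ↔ (y, x) ∈ I.roleSem r := by cases r <;> rfl

theorem transR_invr (P : Set NR) (r : Role NR) : TransR P r.invr ↔ TransR P r := by
  cases r <;> rfl

theorem subRole_invr {H : Set (Role NR × Role NR)} {r s : Role NR} (h : subRole H r s) :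
    subRole H r.invr s.invr := by
  unfold subRole at *
  induction h with
  | refl => exact .refl
  | tail _ h ih =>
    refine ih.tail ?_
    rw [invr_invr, invr_invr]
    exact h.symm

theorem subRole_invr_iff {H : Set (Role NR × Role NR)} {r s : Role NR} :
    subRole H r.invr s ↔ subRole H r s.invr := by
  constructor
  · intro h; simpa [invr_invr] using subRole_invr h
  · intro h; simpa [invr_invr] using subRole_invr h

theorem self_mem_subs (D : Concept NC NR) : D ∈ subs D := by
  cases D <;> simp [subs]

theorem nnf_neg {D : Concept NC NR} (h : IsNNF D) : IsNNF (nnfNeg D) := by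
  induction D with
  | neg C ih => cases C <;> simp_all [IsNNF, nnfNeg]
  | atLeast n r C ih => cases n <;> simp_all [IsNNF, nnfNeg]
  | _ => simp_all [IsNNF, nnfNeg]

theorem nnf_of_neg {D : Concept NC NR} (h : IsNNF (.neg D)) : IsNNF D := by
  cases D <;> simp_all [IsNNF]

theorem nnf_subs {D E : Concept NC NR} (h : IsNNF D) (hE : E ∈ subs D) : IsNNF E := by
  induction D with
  | neg C ih =>
    rcases hE with rfl | hE
    · exact h
    · exact ih (nnf_of_neg h) hE
  | top | bot | atom =>
    simp only [subs, Set.mem_singleton_iff] at hE; subst hE; exact h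
  | inter A B iA iB | union A B iA iB =>
    rcases hE with rfl | hE | hE
    · exact h
    · exact iA h.1 hE
    · exact iB h.2 hE
  | all r A iA | ex r A iA | atLeast n r A iA | atMost n r A iA =>
    rcases hE with rfl | hE
    · exact h
    · exact iA h hE

theorem wf_neg {H : Set (Role NR × Role NR)} {P : Set NR} {D : Concept NC NR}
    (h : WF H P D) : WF H P (nnfNeg D) := by
  induction D with
  | atLeast n r C ih => cases n <;> simp_all [WF, nnfNeg]
  | _ => simp_all [WF, nnfNeg]

theorem wf_subs {H : Set (Role NR × Role NR)} {P : Set NR} {D E : Concept NC NR}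
    (h : WF H P D) (hE : E ∈ subs D) : WF H P E := by
  induction D with
  | top | bot | atom =>
    simp only [subs, Set.mem_singleton_iff] at hE; subst hE; exact h
  | inter A B iA iB | union A B iA iB =>
    rcases hE with rfl | hE | hE
    · exact h
    · exact iA h.1 hE
    · exact iB h.2 hE
  | neg A iA | all r A iA | ex r A iA =>
    rcases hE with rfl | hE
    · exact h
    · exact iA h hE
  | atLeast n r A iA | atMost n r A iA =>
    rcases hE with rfl | hE
    · exact h
    · exact iA h.2 hE

theorem clos_nnf_wf {H : Set (Role NR × Role NR)} {P : Set NR} {C D : Concept NC NR}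
    (hC : IsNNF C) (hW : WF H P C) (h : InClos H P C D) : IsNNF D ∧ WF H P D := by
  induction h with
  | base => exact ⟨hC, hW⟩
  | subc _ hE ih => exact ⟨nnf_subs ih.1 hE, wf_subs ih.2 hE⟩
  | nnf _ ih => exact ⟨nnf_neg ih.1, wf_neg ih.2⟩
  | trans _ _ _ ih => exact ih

theorem neg3 {D : Concept NC NR} (h : IsNNF D) :
    nnfNeg (nnfNeg (nnfNeg D)) = nnfNeg D := by
  induction D with
  | neg C ih => cases C <;> simp_all [IsNNF, nnfNeg]
  | atLeast n r C ih => cases n <;> simp_all [IsNNF, nnfNeg]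
  | _ => simp_all [IsNNF, nnfNeg]

theorem lt_iff_not_le_enat (n : ℕ) (e : ℕ∞) : ((n + 1 : ℕ) : ℕ∞) ≤ e ↔ ¬ e ≤ (n : ℕ∞) := by
  rw [not_le]
  push_cast
  exact ENat.add_one_le_iff (ENat.coe_ne_top n)

theorem sem_neg (I : Interp NC NR) (D : Concept NC NR) :
    I.sem (nnfNeg D) = (I.sem D)ᶜ := by
  induction D with
  | atLeast n r C ih =>
    cases n with
    | zero => simp [nnfNeg, Interp.sem]
    | succ n =>
      ext x
      simp only [nnfNeg, Interp.sem, Set.mem_setOf_eq, Set.mem_compl_iff, lt_iff_not_le_enat,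
        not_not]
  | atMost n r C ih =>
    ext x
    simp only [nnfNeg, Interp.sem, Set.mem_setOf_eq, Set.mem_compl_iff, lt_iff_not_le_enat]
  | inter A B iA iB => simp [nnfNeg, Interp.sem, iA, iB, Set.compl_inter]
  | union A B iA iB => simp [nnfNeg, Interp.sem, iA, iB, Set.compl_union]
  | all r C ih => ext x; simp [nnfNeg, Interp.sem, ih]
  | ex r C ih => ext x; simp [nnfNeg, Interp.sem, ih]
  | _ => simp [nnfNeg, Interp.sem]

/-! forward -/

theorem roleSem_mono {N : Type} {H : Set (Role NR × Role NR)} (I : Interp N NR)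
    (hH : ∀ p ∈ H, I.roleSem p.1 ⊆ I.roleSem p.2) {r s : Role NR} (h : subRole H r s) :
    I.roleSem r ⊆ I.roleSem s := by
  unfold subRole at h
  induction h with
  | refl => exact subset_rfl
  | tail _ h ih =>
    refine ih.trans ?_
    rcases h with h | h
    · exact hH _ h
    · rintro ⟨x, y⟩ hxy
      have := hH _ h ((roleSem_invr I _ y x).2 hxy)
      exact (roleSem_invr I _ y x).1 this

/-- expansion of an interpretation by the fresh names -/
def expand (I : Interp NC NR) : Interp (NCX NC NR) NR where
  Δ := I.Δ
  nonempty := I.nonempty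
  interpC := Sum.elim I.interpC (fun p => I.sem (.all p.1 p.2))
  interpR := I.interpR

theorem expand_roleSem (I : Interp NC NR) (r : Role NR) :
    (expand I).roleSem r = I.roleSem r := by cases r <;> rfl

theorem expand_up {H : Set (Role NR × Role NR)} (I : Interp NC NR)
    (hH : ∀ p ∈ H, I.roleSem p.1 ⊆ I.roleSem p.2) (r : Role NR) (x y : I.Δ) :
    (∀ s ∈ up H r, (x, y) ∈ (expand I).roleSem s) ↔ (x, y) ∈ I.roleSem r := by
  constructor
  · intro h
    have := h r Relation.ReflTransGen.refl
    rwa [expand_roleSem] at this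
  · intro h s hs
    rw [expand_roleSem]
    exact roleSem_mono I hH hs h

theorem expand_sem {H : Set (Role NR × Role NR)} (I : Interp NC NR)
    (hH : ∀ p ∈ H, I.roleSem p.1 ⊆ I.roleSem p.2) (D : Concept NC NR) :
    (expand I).bsem (tr H D) = I.sem D := by
  induction D with
  | top => rfl
  | bot => rfl
  | atom A => rfl
  | neg C ih => exact congrArg compl ih
  | inter A B iA iB => exact congrArg₂ (· ∩ ·) iA iB
  | union A B iA iB => exact congrArg₂ (· ∪ ·) iA iB
  | all r C ih => rfl
  | ex r C ih =>
    change (I.sem (nnfNeg (.ex r C)))ᶜ = _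
    rw [sem_neg, compl_compl]
  | atLeast n r C ih =>
    ext x
    have : {y : I.Δ | (∀ s ∈ up H r, (x, y) ∈ (expand I).roleSem s) ∧
        y ∈ (expand I).bsem (tr H C)} = {y | (x, y) ∈ I.roleSem r ∧ y ∈ I.sem C} := by
      ext y; exact and_congr (expand_up I hH r x y) (by rw [ih]; exact Iff.rfl)
    exact iff_of_eq (congrArg (fun s : Set I.Δ => (n : ℕ∞) ≤ s.encard) this)
  | atMost n r C ih =>
    ext x
    have : {y : I.Δ | (∀ s ∈ up H r, (x, y) ∈ (expand I).roleSem s) ∧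
        y ∈ (expand I).bsem (tr H C)} = {y | (x, y) ∈ I.roleSem r ∧ y ∈ I.sem C} := by
      ext y; exact and_congr (expand_up I hH r x y) (by rw [ih]; exact Iff.rfl)
    exact iff_of_eq (congrArg (fun s : Set I.Δ => s.encard ≤ (n : ℕ∞)) this)

theorem roleSem_trans {P : Set NR} (I : Interp NC NR)
    (hT : ∀ R ∈ P, ∀ a b c : I.Δ,
      (a, b) ∈ I.interpR R → (b, c) ∈ I.interpR R → (a, c) ∈ I.interpR R)
    {t : Role NR} (ht : TransR P t) (a b c : I.Δ) (h1 : (a, b) ∈ I.roleSem t)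
    (h2 : (b, c) ∈ I.roleSem t) : (a, c) ∈ I.roleSem t := by
  cases t with
  | name R => exact hT R ht a b c h1 h2
  | inv R => exact hT R ht c b a h2 h1

/-! backward -/

/-- interpretation of `R↑` -/
def bR {N : Type} (H : Set (Role NR × Role NR)) (I : Interp N NR) (r : Role NR)
    (x y : I.Δ) : Prop := ∀ s ∈ up H r, (x, y) ∈ I.roleSem s

/-- new role extension -/
def nR {N : Type} (H : Set (Role NR × Role NR)) (P : Set NR) (I : Interp N NR) (r : Role NR)
    (x y : I.Δ) : Prop :=
  bR H I r x y ∨ ∃ t, subRole H t r ∧ TransR P t ∧ Relation.TransGen (bR H I t) x y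

theorem bR_mono {N : Type} {H : Set (Role NR × Role NR)} {I : Interp N NR} {r s : Role NR}
    (h : subRole H r s) {x y : I.Δ} (hb : bR H I r x y) : bR H I s x y :=
  fun u hu => hb u (Relation.ReflTransGen.trans h hu)

theorem bR_invr {N : Type} {H : Set (Role NR × Role NR)} {I : Interp N NR} {r : Role NR}
    {x y : I.Δ} (h : bR H I r x y) : bR H I r.invr y x := by
  intro s hs
  have := h s.invr (subRole_invr_iff.1 hs)
  exact (roleSem_invr I s x y).1 this

theorem nR_invr {N : Type} {H : Set (Role NR × Role NR)} {P : Set NR} {I : Interp N NR}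
    {r : Role NR} {x y : I.Δ} (h : nR H P I r x y) : nR H P I r.invr y x := by
  rcases h with h | ⟨t, h1, h2, h3⟩
  · exact Or.inl (bR_invr h)
  · refine Or.inr ⟨t.invr, subRole_invr h1, (transR_invr P t).2 h2, ?_⟩
    induction h3 with
    | single h => exact .single (bR_invr h)
    | tail _ h ih => exact .head (bR_invr h) ih

theorem nR_mono {N : Type} {H : Set (Role NR × Role NR)} {P : Set NR} {I : Interp N NR}
    {r s : Role NR} (h : subRole H r s) {x y : I.Δ} (hb : nR H P I r x y) :
    nR H P I s x y := by
  rcases hb with hb | ⟨t, h1, h2, h3⟩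
  · exact Or.inl (bR_mono h hb)
  · exact Or.inr ⟨t, Relation.ReflTransGen.trans h1 h, h2, h3⟩

theorem nR_gen {N : Type} {H : Set (Role NR × Role NR)} {P : Set NR} {I : Interp N NR}
    {r : Role NR} {x y : I.Δ} (h : nR H P I r x y) : Relation.TransGen (bR H I r) x y := by
  rcases h with h | ⟨t, h1, _, h3⟩
  · exact .single h
  · induction h3 with
    | single h => exact .single (bR_mono h1 h)
    | tail _ h ih => exact ih.tail (bR_mono h1 h)

theorem nR_simple {N : Type} {H : Set (Role NR × Role NR)} {P : Set NR} {I : Interp N NR}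
    {r : Role NR} (hs : Simple H P r) {x y : I.Δ} : nR H P I r x y ↔ bR H I r x y := by
  constructor
  · rintro (h | ⟨t, h1, h2, _⟩)
    · exact h
    · exact absurd ⟨t, h2, h1⟩ hs
  · exact Or.inl

/-- the SHIQ model -/
def model (H : Set (Role NR × Role NR)) (P : Set NR) (I : Interp (NCX NC NR) NR) :
    Interp NC NR where
  Δ := I.Δ
  nonempty := I.nonempty
  interpC A := I.interpC (Sum.inl A)
  interpR R := {p | nR H P I (.name R) p.1 p.2}

theorem model_roleSem (H : Set (Role NR × Role NR)) (P : Set NR) (I : Interp (NCX NC NR) NR)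
    (r : Role NR) (x y : I.Δ) : (x, y) ∈ (model H P I).roleSem r ↔ nR H P I r x y := by
  cases r with
  | name R => exact Iff.rfl
  | inv R => exact ⟨fun h => nR_invr (r := .name R) h, fun h => nR_invr (r := .inv R) h⟩

section back
variable {H : Set (Role NR × Role NR)} {P : Set NR} {C : Concept NC NR}
  {I : Interp (NCX NC NR) NR}

theorem ax1 (hax : ∀ ax ∈ TC H P C, I.satBAx ax) {r : Role NR} {D : Concept NC NR}
    (h : InClos H P C (.all r D)) (x : I.Δ) :
    x ∈ I.interpC (Sum.inr (r, D)) ↔ ∀ y, bR H I r x y → y ∈ I.bsem (tr H D) := by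
  have := hax _ (Or.inl ⟨r, D, h, rfl⟩)
  exact Set.ext_iff.1 this x

theorem ax2 (hax : ∀ ax ∈ TC H P C, I.satBAx ax) {r t : Role NR} {D : Concept NC NR}
    (h : InClos H P C (.all r D)) (h1 : subRole H t r) (h2 : TransR P t) {x y : I.Δ}
    (hx : x ∈ I.interpC (Sum.inr (r, D))) (hb : bR H I t x y) :
    y ∈ I.interpC (Sum.inr (t, D)) := by
  have := hax _ (Or.inr ⟨r, t, D, h, h1, h2, rfl⟩)
  exact this hx y hb

theorem tr_neg2 (hC : IsNNF C) (hW : WF H P C) (hax : ∀ ax ∈ TC H P C, I.satBAx ax)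
    (D : Concept NC NR) (h : InClos H P C D) :
    I.bsem (tr H (nnfNeg (nnfNeg D))) = I.bsem (tr H D) := by
  induction D with
  | top => rfl
  | bot => rfl
  | atom A => rfl
  | neg D ih =>
    have := (clos_nnf_wf hC hW h).1
    cases D <;> simp_all [IsNNF, nnfNeg]
  | inter A B iA iB =>
    have hA := iA (h.subc (by simp [subs, self_mem_subs]))
    have hB := iB (h.subc (by simp [subs, self_mem_subs]))
    exact congrArg₂ (· ∩ ·) hA hB
  | union A B iA iB =>
    have hA := iA (h.subc (by simp [subs, self_mem_subs]))
    have hB := iB (h.subc (by simp [subs, self_mem_subs]))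
    exact congrArg₂ (· ∪ ·) hA hB
  | all r D ih =>
    have hD := ih (h.subc (by simp [subs, self_mem_subs]))
    have h2 : InClos H P C (.all r (nnfNeg (nnfNeg D))) := h.nnf.nnf
    ext x
    refine (ax1 hax h2 x).trans (Iff.trans ?_ (ax1 hax h x).symm)
    rw [hD]
  | ex r D ih =>
    have := neg3 (clos_nnf_wf hC hW (h.subc (E := D) (by simp [subs, self_mem_subs]))).1
    simp only [nnfNeg, tr, this]
  | atLeast n r D ih =>
    cases n with
    | zero => ext x; simp [nnfNeg, tr, Interp.bsem]
    | succ n => rfl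
  | atMost n r D ih => rfl

theorem tr_neg (hC : IsNNF C) (hW : WF H P C) (hax : ∀ ax ∈ TC H P C, I.satBAx ax)
    (D : Concept NC NR) (h : InClos H P C D) :
    I.bsem (tr H (nnfNeg D)) = (I.bsem (tr H D))ᶜ := by
  induction D with
  | top => simp [nnfNeg, tr, Interp.bsem]
  | bot => simp [nnfNeg, tr, Interp.bsem]
  | atom A => rfl
  | neg D ih => simp [nnfNeg, tr, Interp.bsem]
  | inter A B iA iB =>
    have hA := iA (h.subc (by simp [subs, self_mem_subs]))
    have hB := iB (h.subc (by simp [subs, self_mem_subs]))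
    simp [nnfNeg, tr, Interp.bsem, hA, hB, Set.compl_inter]
  | union A B iA iB =>
    have hA := iA (h.subc (by simp [subs, self_mem_subs]))
    have hB := iB (h.subc (by simp [subs, self_mem_subs]))
    simp [nnfNeg, tr, Interp.bsem, hA, hB, Set.compl_union]
  | all r D ih =>
    exact congrArg compl (tr_neg2 hC hW hax _ h)
  | ex r D ih => simp [nnfNeg, tr, Interp.bsem]
  | atLeast n r D ih =>
    cases n with
    | zero => simp [nnfNeg, tr, Interp.bsem]
    | succ n =>
      ext x
      simp only [nnfNeg, tr, Interp.bsem, Set.mem_setOf_eq, Set.mem_compl_iff,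
        lt_iff_not_le_enat, not_not]
  | atMost n r D ih =>
    ext x
    simp only [nnfNeg, tr, Interp.bsem, Set.mem_setOf_eq, Set.mem_compl_iff,
      lt_iff_not_le_enat]

theorem all_new (hax : ∀ ax ∈ TC H P C, I.satBAx ax) {r : Role NR} {D : Concept NC NR}
    (h : InClos H P C (.all r D)) (x : I.Δ) :
    x ∈ I.interpC (Sum.inr (r, D)) ↔ ∀ y, nR H P I r x y → y ∈ I.bsem (tr H D) := by
  constructor
  · rintro hx y (hb | ⟨t, h1, h2, h3⟩)
    · exact (ax1 hax h x).1 hx y hb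
    · have ht : InClos H P C (.all t D) := h.trans h1 h2
      have key : y ∈ I.bsem (tr H D) ∧ y ∈ I.interpC (Sum.inr (t, D)) := by
        induction h3 with
        | single hb =>
          exact ⟨(ax1 hax h x).1 hx _ (bR_mono h1 hb), ax2 hax h h1 h2 hx hb⟩
        | tail _ hb ih =>
          exact ⟨(ax1 hax ht _).1 ih.2 _ hb,
            ax2 hax ht Relation.ReflTransGen.refl h2 ih.2 hb⟩
      exact key.1
  · intro hx
    exact (ax1 hax h x).2 (fun y hb => hx y (Or.inl hb))

theorem model_sem (hC : IsNNF C) (hW : WF H P C) (hax : ∀ ax ∈ TC H P C, I.satBAx ax)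
    (D : Concept NC NR) (h : InClos H P C D) :
    (model H P I).sem D = I.bsem (tr H D) := by
  induction D with
  | top => rfl
  | bot => rfl
  | atom A => rfl
  | neg D ih => exact congrArg compl (ih (h.subc (by simp [subs, self_mem_subs])))
  | inter A B iA iB =>
    have hA := iA (h.subc (by simp [subs, self_mem_subs]))
    have hB := iB (h.subc (by simp [subs, self_mem_subs]))
    exact congrArg₂ (· ∩ ·) hA hB
  | union A B iA iB =>
    have hA := iA (h.subc (by simp [subs, self_mem_subs]))
    have hB := iB (h.subc (by simp [subs, self_mem_subs]))
    exact congrArg₂ (· ∪ ·) hA hB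
  | all r D ih =>
    have hD := ih (h.subc (by simp [subs, self_mem_subs]))
    ext x
    refine Iff.trans ?_ (all_new hax h x).symm
    change (∀ y : I.Δ, (x, y) ∈ (model H P I).roleSem r → y ∈ (model H P I).sem D) ↔ _
    simp only [hD]
    exact forall_congr' fun y => imp_congr (model_roleSem H P I r x y) Iff.rfl
  | ex r D ih =>
    have hc : InClos H P C D := h.subc (by simp [subs, self_mem_subs])
    have hD := ih hc
    have h2 : InClos H P C (.all r (nnfNeg D)) := h.nnf
    ext x
    refine Iff.trans ?_ (not_congr (all_new hax h2 x)).symm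
    rw [tr_neg hC hW hax D hc]
    change (∃ y : I.Δ, (x, y) ∈ (model H P I).roleSem r ∧ y ∈ (model H P I).sem D) ↔ _
    rw [hD]
    push Not
    refine exists_congr fun y => and_congr (model_roleSem H P I r x y) ?_
    simp
    exact Iff.rfl
  | atLeast n r D ih =>
    have hD := ih (h.subc (by simp [subs, self_mem_subs]))
    have hs : Simple H P r := (clos_nnf_wf hC hW h).2.1
    ext x
    have : {y : I.Δ | (x, y) ∈ (model H P I).roleSem r ∧ y ∈ (model H P I).sem D} =
        {y | (∀ s ∈ up H r, (x, y) ∈ I.roleSem s) ∧ y ∈ I.bsem (tr H D)} := by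
      ext y
      exact and_congr ((model_roleSem H P I r x y).trans (nR_simple hs)) (by rw [hD]; exact Iff.rfl)
    exact iff_of_eq (congrArg (fun s : Set I.Δ => (n : ℕ∞) ≤ s.encard) this)
  | atMost n r D ih =>
    have hD := ih (h.subc (by simp [subs, self_mem_subs]))
    have hs : Simple H P r := (clos_nnf_wf hC hW h).2.1
    ext x
    have : {y : I.Δ | (x, y) ∈ (model H P I).roleSem r ∧ y ∈ (model H P I).sem D} =
        {y | (∀ s ∈ up H r, (x, y) ∈ I.roleSem s) ∧ y ∈ I.bsem (tr H D)} := by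
      ext y
      exact and_congr ((model_roleSem H P I r x y).trans (nR_simple hs)) (by rw [hD]; exact Iff.rfl)
    exact iff_of_eq (congrArg (fun s : Set I.Δ => s.encard ≤ (n : ℕ∞)) this)

end back

/-- Reduction of SHIQ to role conjunctions and TBoxes: for a SHIQ-concept `C` in NNF
and a cycle-free role hierarchy `R`, `C` is satisfiable w.r.t. `R` (with transitive
role names interpreted transitively) iff `C^tr` is satisfiable w.r.t. the TBox `T_C`,
where in the latter problem all roles are interpreted by arbitrary binary relations
with no transitivity or hierarchy requirements. -/
theorem shiq_to_alcqib_tbox (NRplus : Set NR) (H : Set (Role NR × Role NR))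
    (hfin : H.Finite)
    (hcf : ∀ a b : Role NR, subRole H a b → subRole H b a → a = b)
    (C : Concept NC NR) (hC : IsNNF C) (hWF : WF H NRplus C) :
    Sat NRplus H C ↔
    (∃ I : Interp (NCX NC NR) NR,
      (∀ ax ∈ TC H NRplus C, I.satBAx ax) ∧ (I.bsem (tr H C)).Nonempty) := by
  constructor
  · rintro ⟨I, hT, hH, hne⟩
    refine ⟨expand I, ?_, ?_⟩
    · rintro ax (⟨r, D, _, rfl⟩ | ⟨r, t, D, _, h1, h2, rfl⟩)
      · apply Set.ext
        intro x
        change (∀ y : I.Δ, (x, y) ∈ I.roleSem r → y ∈ I.sem D) ↔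
          ∀ y : I.Δ, (∀ s ∈ up H r, (x, y) ∈ (expand I).roleSem s) →
            y ∈ (expand I).bsem (tr H D)
        rw [expand_sem I hH D]
        exact forall_congr' fun y => imp_congr (expand_up I hH r x y).symm Iff.rfl
      · intro x hx y hy z hz
        have hy' := (expand_up I hH t x y).1 hy
        exact hx z (roleSem_mono I hH h1 (roleSem_trans I hT h2 x y z hy' hz))
    · rw [expand_sem I hH C]
      exact hne
  · rintro ⟨I, hax, hne⟩
    refine ⟨model H NRplus I, ?_, ?_, ?_⟩
    · intro R hR a b c h1 h2
      exact Or.inr ⟨.name R, Relation.ReflTransGen.refl, hR, (nR_gen h1).trans (nR_gen h2)⟩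
    · rintro ⟨r, s⟩ hp ⟨x, y⟩ hxy
      refine (model_roleSem H NRplus I s x y).2 (nR_mono ?_ ((model_roleSem H NRplus I r x y).1 hxy))
      exact Relation.ReflTransGen.single (Or.inl hp)
    · rw [model_sem hC hWF hax C .base]
      exact hne


end Stmt16
end
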